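/- Let $p$ be prime, $l \geq 1$, and $P_1(t), \dots, P_l(t) \in \mathbb{Z}_p[t]$ monic polynomials of degree at most $2$ with distinct irreducible reductions mod $p$. For each $j$, let $G_j$ be a finite module over $\mathbb{Z}_p[t]/(P_j(t))$. Then $\lim_{n \to \infty} \mathrm{Prob}_{X \in \mathrm{Mat}_n(\mathbb{Z}_p)}\big(\mathrm{cok}(P_j(X)) \simeq G_j \text{ for all } 1 \leq j \leq l\big) = \prod_{j=1}^{l} \frac{1}{|\mathrm{Aut}_{\mathbb{Z}_p[t]/(P_j(t))}(G_j)|} \prod_{i=1}^{\infty}\big(1 - p^{-i \deg P_j}\big)$. -/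

import Mathlib

open MeasureTheory

noncomputable instance (p : ℕ) [Fact p.Prime] : MeasurableSpace ℤ_[p] := borel _

section Helpers13
set_option linter.unusedSectionVars false
set_option linter.style.haveILetI false
open Filter Topology MeasureTheory Polynomial

section PartA1
open Filter Topology

/-- `γ q m = ∏_{i=1}^m (q^i - 1)`. -/
noncomputable def gam (q : ℝ) (m : ℕ) : ℝ := ∏ i ∈ Finset.range m, (q ^ (i + 1) - 1)

lemma gam_succ (q : ℝ) (m : ℕ) : gam q (m + 1) = gam q m * (q ^ (m + 1) - 1) := by
  simp [gam, Finset.prod_range_succ]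

lemma gam_ge {q : ℝ} (hq : 2 ≤ q) (m : ℕ) : (2 : ℝ) ^ m ≤ 2 * gam q m := by
  induction m with
  | zero => simp [gam]
  | succ m ih =>
    rw [gam_succ]
    rcases Nat.eq_zero_or_pos m with rfl | hm
    · simp [gam]; linarith
    · have h1 : (3 : ℝ) ≤ q ^ (m + 1) := by
        calc (3 : ℝ) ≤ 2 ^ 2 := by norm_num
          _ ≤ q ^ 2 := by gcongr
          _ ≤ q ^ (m + 1) := pow_le_pow_right₀ (by linarith) (by omega)
      have h2 : (0 : ℝ) < 2 ^ m := by positivity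
      rw [pow_succ]; nlinarith

lemma gam_pos {q : ℝ} (hq : 2 ≤ q) (m : ℕ) : 0 < gam q m := by
  have := gam_ge hq m
  have h2 : (0 : ℝ) < 2 ^ m := by positivity
  linarith

lemma gam_ge_one {q : ℝ} (hq : 2 ≤ q) (m : ℕ) : 1 ≤ gam q m := by
  rcases Nat.eq_zero_or_pos m with rfl | hm
  · simp [gam]
  · have := gam_ge hq m
    have h2 : (2 : ℝ) ^ 1 ≤ 2 ^ m := pow_le_pow_right₀ (by norm_num) hm
    linarith

lemma inv_gam_le {q : ℝ} (hq : 2 ≤ q) (m : ℕ) : (gam q m)⁻¹ ≤ 2 * (1 / 2 : ℝ) ^ m := by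
  have h2 : (0 : ℝ) < 2 ^ m := by positivity
  rw [inv_le_iff_one_le_mul₀ (gam_pos hq m), one_div, inv_pow]
  have := gam_ge hq m
  field_simp
  linarith

lemma summable_inv_gam {q : ℝ} (hq : 2 ≤ q) : Summable fun m => (gam q m)⁻¹ := by
  refine Summable.of_nonneg_of_le (fun m => (inv_pos.2 (gam_pos hq m)).le) (inv_gam_le hq) ?_
  exact (summable_geometric_of_lt_one (by norm_num) (by norm_num)).mul_left _

lemma tendsto_inv_gam {q : ℝ} (hq : 2 ≤ q) : Tendsto (fun m => (gam q m)⁻¹) atTop (𝓝 0) :=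
  (summable_inv_gam hq).tendsto_atTop_zero

lemma euler_aux {q : ℝ} (hq : 2 ≤ q) (j : ℕ) :
    Summable fun k => (-1 : ℝ) ^ k * (q⁻¹ ^ j) ^ k * (gam q k)⁻¹ := by
  refine Summable.of_norm_bounded (summable_inv_gam hq) fun k => ?_
  have h0 : 0 ≤ q⁻¹ := inv_nonneg.2 (by linarith)
  have h1 : q⁻¹ ≤ 1 := inv_le_one_of_one_le₀ (by linarith)
  have hg := gam_pos hq k
  rw [norm_mul, norm_mul, norm_pow, norm_neg, norm_one, one_pow, one_mul, Real.norm_of_nonneg (by positivity),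
    Real.norm_of_nonneg (by positivity)]
  exact mul_le_of_le_one_left (by positivity) (pow_le_one₀ (by positivity) (pow_le_one₀ h0 h1))

lemma euler_step {q : ℝ} (hq : 2 ≤ q) (j : ℕ) :
    ∑' k, (-1 : ℝ) ^ k * (q⁻¹ ^ j) ^ k * (gam q k)⁻¹ =
      (1 - q⁻¹ ^ (j + 1)) * ∑' k, (-1 : ℝ) ^ k * (q⁻¹ ^ (j + 1)) ^ k * (gam q k)⁻¹ := by
  have hq0 : q ≠ 0 := by linarith
  have hA := euler_aux hq j
  have hB := euler_aux hq (j + 1)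
  have key : ∑' k, ((-1 : ℝ) ^ k * (q⁻¹ ^ j) ^ k * (gam q k)⁻¹ -
      (-1 : ℝ) ^ k * (q⁻¹ ^ (j + 1)) ^ k * (gam q k)⁻¹) =
      ∑' k, (- q⁻¹ ^ (j + 1)) * ((-1 : ℝ) ^ k * (q⁻¹ ^ (j + 1)) ^ k * (gam q k)⁻¹) := by
    rw [(hA.sub hB).tsum_eq_zero_add]
    simp only [pow_zero, sub_self, zero_add]
    refine tsum_congr fun k => ?_
    have h1 := (gam_pos hq k).ne'
    have h2 := (gam_pos hq (k + 1)).ne'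
    have h3 : q ^ (k + 1) - 1 ≠ 0 := by
      intro h; rw [gam_succ, h, mul_zero] at h2; exact h2 rfl
    rw [gam_succ]
    have hk : q ^ (k + 1) * q⁻¹ ^ (k + 1) = 1 := by
      rw [← mul_pow, mul_inv_cancel₀ hq0, one_pow]
    field_simp
    linear_combination (q⁻¹ ^ (k * j) * q⁻¹ ^ j * (-1) ^ k) * hk
  rw [hA.tsum_sub hB, tsum_mul_left] at key
  linear_combination key

lemma euler_multipliable {q : ℝ} (hq : 2 ≤ q) : Multipliable fun i : ℕ => 1 - q⁻¹ ^ (i + 1) := by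
  have h0 : 0 ≤ q⁻¹ := inv_nonneg.2 (by linarith)
  have h1 : q⁻¹ < 1 := inv_lt_one_of_one_lt₀ (by linarith)
  simp_rw [sub_eq_add_neg]
  apply multipliable_one_add_of_summable
  have := (summable_geometric_of_lt_one h0 h1)
  rw [← summable_nat_add_iff 1] at this
  refine this.congr fun b => ?_
  rw [norm_neg, Real.norm_of_nonneg (by positivity)]

lemma euler {q : ℝ} (hq : 2 ≤ q) :
    Tendsto (fun M => ∑ m ∈ Finset.range (M + 1), (-1 : ℝ) ^ m * (gam q m)⁻¹) atTop
      (𝓝 (∏' i : ℕ, (1 - q⁻¹ ^ (i + 1)))) := by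
  have h0 : 0 ≤ q⁻¹ := inv_nonneg.2 (by linarith)
  have h1 : q⁻¹ < 1 := inv_lt_one_of_one_lt₀ (by linarith)
  set F : ℕ → ℝ := fun j => ∑' k, (-1 : ℝ) ^ k * (q⁻¹ ^ j) ^ k * (gam q k)⁻¹ with hF
  have hprod : ∀ N, F 0 = (∏ i ∈ Finset.range N, (1 - q⁻¹ ^ (i + 1))) * F N := by
    intro N
    induction N with
    | zero => simp
    | succ N ih =>
      rw [ih, Finset.prod_range_succ, mul_assoc]
      congr 1
      exact euler_step hq N
  have hlim : Tendsto F atTop (𝓝 1) := by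
    have : Tendsto F atTop (𝓝 (∑' k, if k = 0 then (1 : ℝ) else 0)) := by
      refine tendsto_tsum_of_dominated_convergence (summable_inv_gam hq) (fun k => ?_)
        (Eventually.of_forall fun j k => ?_)
      · rcases Nat.eq_zero_or_pos k with rfl | hk
        · simp [gam]
        · have : Tendsto (fun j : ℕ => (-1 : ℝ) ^ k * (q⁻¹ ^ j) ^ k * (gam q k)⁻¹) atTop
              (𝓝 ((-1 : ℝ) ^ k * (0) ^ k * (gam q k)⁻¹)) :=
            (((tendsto_pow_atTop_nhds_zero_of_lt_one h0 h1).pow k).const_mul _).mul_const _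
          simpa [hk.ne'] using this
      · have hg := gam_pos hq k
        rw [norm_mul, norm_mul, norm_pow, norm_neg, norm_one, one_pow, one_mul,
          Real.norm_of_nonneg (by positivity), Real.norm_of_nonneg (by positivity)]
        exact mul_le_of_le_one_left (by positivity)
          (pow_le_one₀ (by positivity) (pow_le_one₀ h0 h1.le))
    simpa using this
  have hlim2 : Tendsto (fun N => (∏ i ∈ Finset.range N, (1 - q⁻¹ ^ (i + 1))) * F N) atTop
      (𝓝 ((∏' i : ℕ, (1 - q⁻¹ ^ (i + 1))) * 1)) :=
    ((euler_multipliable hq).hasProd.tendsto_prod_nat).mul hlim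
  have h3 : F 0 = ∏' i : ℕ, (1 - q⁻¹ ^ (i + 1)) := by
    rw [mul_one] at hlim2
    refine tendsto_nhds_unique ?_ hlim2
    simp_rw [← hprod]
    exact tendsto_const_nhds
  rw [← h3]
  have h4 := (euler_aux hq 0).hasSum.tendsto_sum_nat
  simp only [pow_zero, one_pow, mul_one] at h4
  have h5 := h4.comp (tendsto_add_atTop_nat 1)
  simpa [hF, Function.comp_def] using h5

end PartA1

section PartA2
open Filter Topology MeasureTheory

/-- `∏_{i<m} (q^r - q^i)`: the number of linearly independent `m`-tuples in `𝔽_q^r`. -/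
noncomputable def sfun (q : ℝ) (m r : ℕ) : ℝ := ∏ i ∈ Finset.range m, (q ^ r - q ^ i)

lemma sfun_eq_zero (q : ℝ) {m r : ℕ} (h : r < m) : sfun q m r = 0 :=
  Finset.prod_eq_zero (Finset.mem_range.2 h) (sub_self _)

lemma sfun_nonneg {q : ℝ} (hq : 2 ≤ q) (m r : ℕ) : 0 ≤ sfun q m r := by
  rcases lt_or_ge r m with h | h
  · rw [sfun_eq_zero q h]
  · refine Finset.prod_nonneg fun i hi => ?_
    rw [Finset.mem_range] at hi
    have : q ^ i ≤ q ^ r := pow_le_pow_right₀ (by linarith) (by omega)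
    linarith

lemma sfun_sum {q : ℝ} (hq : 2 ≤ q) (M r : ℕ) :
    ∑ m ∈ Finset.range (M + 1), (-1 : ℝ) ^ m * (gam q m)⁻¹ * sfun q m r =
      (∏ i ∈ Finset.range M, (q ^ (i + 1) - q ^ r)) * (gam q M)⁻¹ := by
  induction M with
  | zero => simp [gam, sfun]
  | succ M ih =>
    rw [Finset.sum_range_succ, ih, Finset.prod_range_succ, gam_succ]
    have h1 := (gam_pos hq M).ne'
    have h2 := (gam_pos hq (M + 1)).ne'
    have h3 : q ^ (M + 1) - 1 ≠ 0 := by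
      intro h; rw [gam_succ, h, mul_zero] at h2; exact h2 rfl
    have h4 : (-1 : ℝ) ^ (M + 1) * sfun q (M + 1) r =
        (1 - q ^ r) * ∏ i ∈ Finset.range M, (q ^ (i + 1) - q ^ r) := by
      have : ∏ i ∈ Finset.range (M + 1), (-1 : ℝ) * (q ^ r - q ^ i) =
          (1 - q ^ r) * ∏ i ∈ Finset.range M, (q ^ (i + 1) - q ^ r) := by
        rw [Finset.prod_range_succ', mul_comm]
        simp
      rw [← this, Finset.prod_mul_distrib, sfun]
      simp
    field_simp
    linear_combination h4

lemma sieve_one {q : ℝ} (hq : 2 ≤ q) (M r : ℕ) :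
    |(if r = 0 then (1 : ℝ) else 0) -
      ∑ m ∈ Finset.range (M + 1), (-1 : ℝ) ^ m * (gam q m)⁻¹ * sfun q m r| ≤
      (gam q (M + 1))⁻¹ * sfun q (M + 1) r := by
  have hg := gam_pos hq M
  have hg' := gam_pos hq (M + 1)
  have hs := sfun_nonneg hq (M + 1) r
  rw [sfun_sum hq]
  split_ifs with h0
  · subst h0
    have : ∏ i ∈ Finset.range M, (q ^ (i + 1) - q ^ 0) = gam q M := by simp [gam]
    rw [this, mul_inv_cancel₀ hg.ne', sub_self, abs_zero]
    positivity
  · rcases le_or_gt r M with h | h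
    · rw [Finset.prod_eq_zero (i := r - 1) (Finset.mem_range.2 (by omega))]
      · simp; positivity
      · rw [Nat.sub_add_cancel (by omega), sub_self]
    · have h1 : |∏ i ∈ Finset.range M, (q ^ (i + 1) - q ^ r)| =
          ∏ i ∈ Finset.range M, (q ^ r - q ^ (i + 1)) := by
        rw [Finset.abs_prod]
        refine Finset.prod_congr rfl fun i hi => ?_
        rw [Finset.mem_range] at hi
        have : q ^ (i + 1) ≤ q ^ r := pow_le_pow_right₀ (by linarith) (by omega)
        rw [abs_sub_comm, abs_of_nonneg (by linarith)]
      have h2 : sfun q (M + 1) r =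
          (q ^ r - 1) * ∏ i ∈ Finset.range M, (q ^ r - q ^ (i + 1)) := by
        rw [sfun, Finset.prod_range_succ', mul_comm, pow_zero]
      have h3 : 0 ≤ ∏ i ∈ Finset.range M, (q ^ r - q ^ (i + 1)) := by
        rw [← h1]; exact abs_nonneg _
      rw [zero_sub, abs_neg, abs_mul, h1, abs_of_pos (inv_pos.2 hg), h2, gam_succ]
      have h4 : q ^ (M + 1) ≤ q ^ r := pow_le_pow_right₀ (by linarith) (by omega)
      have h5 : 0 < q ^ (M + 1) - 1 := by
        have : q ^ 1 ≤ q ^ (M + 1) := pow_le_pow_right₀ (by linarith) (by omega)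
        linarith
      rw [mul_inv]
      have : 1 ≤ (q ^ (M + 1) - 1)⁻¹ * (q ^ r - 1) := by
        rw [inv_mul_eq_div, one_le_div h5]; linarith
      set D := ∏ i ∈ Finset.range M, (q ^ r - q ^ (i + 1))
      calc D * (gam q M)⁻¹ = D * (gam q M)⁻¹ * 1 := by ring
        _ ≤ D * (gam q M)⁻¹ * ((q ^ (M + 1) - 1)⁻¹ * (q ^ r - 1)) := by gcongr
        _ = _ := by ring

lemma abs_prod_sub_prod {ι : Type*} (s : Finset ι) (a b e : ι → ℝ) (ha : ∀ j, |a j| ≤ 1)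
    (h : ∀ j, |a j - b j| ≤ e j) :
    |∏ j ∈ s, a j - ∏ j ∈ s, b j| ≤ ∏ j ∈ s, (1 + e j) - 1 := by
  classical
  have he : ∀ j, 0 ≤ e j := fun j => (abs_nonneg _).trans (h j)
  induction s using Finset.induction_on with
  | empty => simp
  | insert i s hi ih =>
    rw [Finset.prod_insert hi, Finset.prod_insert hi, Finset.prod_insert hi]
    have hb : |b i| ≤ 1 + e i := by
      have := abs_sub_abs_le_abs_sub (b i) (a i)
      rw [abs_sub_comm] at this
      linarith [h i, ha i]
    have hA : |∏ j ∈ s, a j| ≤ 1 := by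
      rw [Finset.abs_prod]; exact Finset.prod_le_one (fun _ _ => abs_nonneg _) (fun j _ => ha j)
    calc |a i * ∏ j ∈ s, a j - b i * ∏ j ∈ s, b j|
        = |(a i - b i) * ∏ j ∈ s, a j + b i * (∏ j ∈ s, a j - ∏ j ∈ s, b j)| := by congr 1; ring
      _ ≤ |(a i - b i) * ∏ j ∈ s, a j| + |b i * (∏ j ∈ s, a j - ∏ j ∈ s, b j)| := abs_add_le _ _
      _ ≤ e i * 1 + (1 + e i) * (∏ j ∈ s, (1 + e j) - 1) := by
          rw [abs_mul, abs_mul]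
          have := he i
          gcongr
          exact h i
      _ = _ := by ring

lemma sieve_pointwise {ι : Type*} [Fintype ι] [DecidableEq ι] (q : ι → ℝ) (hq : ∀ j, 2 ≤ q j) (M : ℕ)
    (r : ι → ℕ) :
    |(if ∀ j, r j = 0 then (1 : ℝ) else 0) -
      ∑ m ∈ Fintype.piFinset (fun _ : ι => Finset.range (M + 1)),
        (∏ j, ((-1 : ℝ) ^ m j * (gam (q j) (m j))⁻¹)) * ∏ j, sfun (q j) (m j) (r j)| ≤
      ∑ S ∈ (Finset.univ : Finset ι).powerset.erase ∅,
        (∏ j ∈ S, (gam (q j) (M + 1))⁻¹) *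
          ∏ j, sfun (q j) (if j ∈ S then M + 1 else 0) (r j) := by
  have h1 := abs_prod_sub_prod (Finset.univ : Finset ι) (fun j => if r j = 0 then (1 : ℝ) else 0)
    (fun j => ∑ m ∈ Finset.range (M + 1), (-1 : ℝ) ^ m * (gam (q j) m)⁻¹ * sfun (q j) m (r j))
    (fun j => (gam (q j) (M + 1))⁻¹ * sfun (q j) (M + 1) (r j))
    (fun j => by split_ifs <;> simp) (fun j => sieve_one (hq j) M (r j))
  rw [Finset.prod_univ_sum, Finset.prod_ite_zero] at h1
  simp only [Finset.prod_const_one, Finset.mem_univ, true_imp_iff, Finset.prod_mul_distrib] at h1 ⊢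
  refine h1.trans (le_of_eq ?_)
  rw [Finset.prod_one_add, ← Finset.add_sum_erase _ _ (Finset.mem_powerset.2 (Finset.empty_subset _))]
  simp only [Finset.prod_empty, add_sub_cancel_left]
  refine Finset.sum_congr rfl fun S _ => ?_
  rw [Finset.prod_mul_distrib]
  congr 1
  rw [← Finset.prod_subset (Finset.subset_univ S)]
  · exact Finset.prod_congr rfl fun j hj => by rw [if_pos hj]
  · intro j _ hj; simp [hj, sfun]

lemma sieve_bound {ι : Type*} [Fintype ι] [DecidableEq ι] (q : ι → ℝ) (hq : ∀ j, 2 ≤ q j) (M : ℕ)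
    (η : ℝ) {Ω : Type*} [MeasurableSpace Ω] (μ : Measure Ω) [IsFiniteMeasure μ]
    (A B : Set Ω) (r : Ω → ι → ℕ) (Y : (ι → ℕ) → Ω → ℝ) (w : ℝ) (hw : 0 ≤ w)
    (hYi : ∀ m, Integrable (Y m) μ)
    (hYA : ∀ m, ∀ ω ∈ A, Y m ω = ∏ j, sfun (q j) (m j) (r ω j))
    (hYA' : ∀ m, ∀ ω ∉ A, Y m ω = 0)
    (hY1 : ∀ m, (∀ j, m j ≤ M + 1) → w * (1 - η) ≤ ∫ ω, Y m ω ∂μ)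
    (hY2 : ∀ m, (∀ j, m j ≤ M + 1) → ∫ ω, Y m ω ∂μ ≤ w)
    (hB : MeasurableSet B) (hBA : ∀ ω, ω ∈ B ↔ ω ∈ A ∧ ∀ j, r ω j = 0) :
    |μ.real B - w * ∏ j, ∑ m ∈ Finset.range (M + 1), (-1 : ℝ) ^ m * (gam (q j) m)⁻¹| ≤
      w * (η * ((Fintype.piFinset (fun _ : ι => Finset.range (M + 1))).card : ℝ) +
        (∏ j, (1 + (gam (q j) (M + 1))⁻¹) - 1)) := by
  classical
  set T := Fintype.piFinset (fun _ : ι => Finset.range (M + 1)) with hT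
  set c : (ι → ℕ) → ℝ := fun m => ∏ j, ((-1 : ℝ) ^ m j * (gam (q j) (m j))⁻¹) with hc
  set d : Finset ι → ℝ := fun S => ∏ j ∈ S, (gam (q j) (M + 1))⁻¹ with hd
  have hd0 : ∀ S, 0 ≤ d S := fun S => Finset.prod_nonneg fun j _ =>
    (inv_pos.2 (gam_pos (hq j) _)).le
  set mS : Finset ι → ι → ℕ := fun S j => if j ∈ S then M + 1 else 0 with hmS
  have hpt : ∀ ω, |B.indicator (fun _ => (1 : ℝ)) ω - ∑ m ∈ T, c m * Y m ω| ≤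
      ∑ S ∈ (Finset.univ : Finset ι).powerset.erase ∅, d S * Y (mS S) ω := by
    intro ω
    by_cases hω : ω ∈ A
    · have := sieve_pointwise q hq M (r ω)
      simp only [hYA _ ω hω]
      convert this using 3
      rw [Set.indicator_apply]
      simp [hBA, hω]
    · have : ω ∉ B := fun h => hω ((hBA ω).1 h).1
      simp [hYA' _ ω hω, this]
  have hint1 : Integrable (B.indicator (fun _ => (1 : ℝ))) μ :=
    (integrable_const _).indicator hB
  have hint2 : Integrable (fun ω => ∑ m ∈ T, c m * Y m ω) μ :=
    integrable_finset_sum _ fun m _ => (hYi m).const_mul _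
  have hint3 : Integrable (fun ω => ∑ S ∈ (Finset.univ : Finset ι).powerset.erase ∅,
      d S * Y (mS S) ω) μ :=
    integrable_finset_sum _ fun m _ => (hYi _).const_mul _
  have e1 : ∫ ω, B.indicator (fun _ => (1 : ℝ)) ω ∂μ = μ.real B := by
    rw [integral_indicator_const _ hB]; simp
  have e2 : ∫ ω, ∑ m ∈ T, c m * Y m ω ∂μ = ∑ m ∈ T, c m * ∫ ω, Y m ω ∂μ := by
    rw [integral_finset_sum _ fun m _ => (hYi m).const_mul _]
    simp_rw [integral_const_mul]
  have e3 : ∫ ω, ∑ S ∈ (Finset.univ : Finset ι).powerset.erase ∅, d S * Y (mS S) ω ∂μ =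
      ∑ S ∈ (Finset.univ : Finset ι).powerset.erase ∅, d S * ∫ ω, Y (mS S) ω ∂μ := by
    rw [integral_finset_sum _ fun m _ => (hYi _).const_mul _]
    simp_rw [integral_const_mul]
  have b1 : |μ.real B - ∑ m ∈ T, c m * ∫ ω, Y m ω ∂μ| ≤ w * (∏ j, (1 + (gam (q j) (M + 1))⁻¹) - 1) := by
    rw [← e1, ← e2, ← integral_sub hint1 hint2]
    refine (abs_integral_le_integral_abs).trans ?_
    refine (integral_mono (hint1.sub hint2).abs hint3 hpt).trans ?_
    rw [e3, Finset.prod_one_add,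
      ← Finset.add_sum_erase _ _ (Finset.mem_powerset.2 (Finset.empty_subset _))]
    simp only [Finset.prod_empty, add_sub_cancel_left]
    rw [Finset.mul_sum]
    refine Finset.sum_le_sum fun S _ => ?_
    rw [mul_comm]
    refine mul_le_mul_of_nonneg_right (hY2 _ fun j => ?_) (hd0 S)
    simp only [hmS]; split_ifs <;> omega
  have b2 : |∑ m ∈ T, c m * ∫ ω, Y m ω ∂μ -
      w * ∏ j, ∑ m ∈ Finset.range (M + 1), (-1 : ℝ) ^ m * (gam (q j) m)⁻¹| ≤ w * (η * (T.card : ℝ)) := by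
    rw [Finset.prod_univ_sum, Finset.mul_sum, ← Finset.sum_sub_distrib]
    refine (Finset.abs_sum_le_sum_abs _ _).trans ?_
    have : ∀ m ∈ T, |c m * ∫ ω, Y m ω ∂μ - w * ∏ j, ((-1 : ℝ) ^ m j * (gam (q j) (m j))⁻¹)| ≤ w * η := by
      intro m hm
      have hm' : ∀ j, m j ≤ M + 1 := fun j => by
        have := Finset.mem_range.1 (Fintype.mem_piFinset.1 hm j); omega
      have h1 := hY1 m hm'
      have h2 := hY2 m hm'
      have hc1 : |c m| ≤ 1 := by
        simp only [hc]
        rw [Finset.abs_prod]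
        refine Finset.prod_le_one (fun _ _ => abs_nonneg _) fun j _ => ?_
        rw [abs_mul, abs_pow, abs_neg, abs_one, one_pow, one_mul,
          abs_of_pos (inv_pos.2 (gam_pos (hq j) _))]
        exact inv_le_one_of_one_le₀ (gam_ge_one (hq j) _)
      have h3 : |∫ ω, Y m ω ∂μ - w| ≤ w * η := by rw [abs_le]; constructor <;> nlinarith
      have : c m * ∫ ω, Y m ω ∂μ - w * ∏ j, ((-1 : ℝ) ^ m j * (gam (q j) (m j))⁻¹) =
        c m * (∫ ω, Y m ω ∂μ - w) := by simp only [hc]; ring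
      rw [this, abs_mul]
      calc |c m| * |∫ ω, Y m ω ∂μ - w| ≤ 1 * (w * η) := by gcongr
        _ = _ := one_mul _
    refine (Finset.sum_le_sum this).trans ?_
    rw [Finset.sum_const, nsmul_eq_mul]
    apply le_of_eq; ring
  have := abs_sub_le (μ.real B) (∑ m ∈ T, c m * ∫ ω, Y m ω ∂μ)
    (w * ∏ j, ∑ m ∈ Finset.range (M + 1), (-1 : ℝ) ^ m * (gam (q j) m)⁻¹)
  linarith

lemma sieve {ι : Type*} [Fintype ι] [DecidableEq ι] (q : ι → ℝ) (hq : ∀ j, 2 ≤ q j)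
    (ε : ℝ) (hε : 0 < ε) : ∃ (M : ℕ) (η : ℝ), 0 < η ∧
    ∀ {Ω : Type} [MeasurableSpace Ω] (μ : Measure Ω) [IsFiniteMeasure μ]
    (A B : Set Ω) (r : Ω → ι → ℕ) (Y : (ι → ℕ) → Ω → ℝ) (w : ℝ) (_ : 0 ≤ w)
    (_ : ∀ m, Integrable (Y m) μ)
    (_ : ∀ m, ∀ ω ∈ A, Y m ω = ∏ j, sfun (q j) (m j) (r ω j))
    (_ : ∀ m, ∀ ω ∉ A, Y m ω = 0)
    (_ : ∀ m, (∀ j, m j ≤ M + 1) → w * (1 - η) ≤ ∫ ω, Y m ω ∂μ)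
    (_ : ∀ m, (∀ j, m j ≤ M + 1) → ∫ ω, Y m ω ∂μ ≤ w)
    (_ : MeasurableSet B) (_ : ∀ ω, ω ∈ B ↔ ω ∈ A ∧ ∀ j, r ω j = 0),
    |μ.real B - w * ∏ j, ∏' i : ℕ, (1 - (q j)⁻¹ ^ (i + 1))| ≤ w * ε := by
  have h1 : Tendsto (fun M => ∏ j, (1 + (gam (q j) (M + 1))⁻¹) - 1) atTop (𝓝 0) := by
    have : Tendsto (fun M => ∏ j, (1 + (gam (q j) (M + 1))⁻¹) - 1) atTop
        (𝓝 (∏ _j : ι, (1 + (0 : ℝ)) - 1)) :=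
      (tendsto_finset_prod _ fun j _ => ((tendsto_inv_gam (hq j)).comp
        (tendsto_add_atTop_nat 1)).const_add _).sub_const _
    simpa using this
  have h2 : Tendsto (fun M => ∏ j, ∑ m ∈ Finset.range (M + 1), (-1 : ℝ) ^ m * (gam (q j) m)⁻¹) atTop
      (𝓝 (∏ j, ∏' i : ℕ, (1 - (q j)⁻¹ ^ (i + 1)))) :=
    tendsto_finset_prod _ fun j _ => euler (hq j)
  have h3 := h1.eventually_lt_const (show (0 : ℝ) < ε / 3 by linarith)
  have h4 := Metric.tendsto_nhds.1 h2 (ε / 3) (by linarith)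
  obtain ⟨M, hM1, hM2⟩ := (h3.and h4).exists
  set C : ℝ := ((Fintype.piFinset (fun _ : ι => Finset.range (M + 1))).card : ℝ) with hC
  have hC0 : 0 ≤ C := Nat.cast_nonneg _
  refine ⟨M, ε / (3 * (C + 1)), by positivity, ?_⟩
  intro Ω _ μ _ A B r Y w hw a1 a2 a3 a4 a5 a6 a7
  have := sieve_bound q hq M _ μ A B r Y w hw a1 a2 a3 a4 a5 a6 a7
  rw [← hC] at this
  have h5 : ε / (3 * (C + 1)) * C ≤ ε / 3 := by
    rw [div_mul_eq_mul_div, div_le_div_iff₀ (by positivity) (by norm_num)]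
    nlinarith
  rw [Real.dist_eq] at hM2
  set U := ∏ j, ∑ m ∈ Finset.range (M + 1), (-1 : ℝ) ^ m * (gam (q j) m)⁻¹
  set L := ∏ j, ∏' i : ℕ, (1 - (q j)⁻¹ ^ (i + 1))
  have h6 : |w * U - w * L| ≤ w * (ε / 3) := by
    rw [← mul_sub, abs_mul, abs_of_nonneg hw]; gcongr
  have h7 := abs_sub_le (μ.real B) (w * U) (w * L)
  have h8 : w * (ε / (3 * (C + 1)) * C + (∏ j, (1 + (gam (q j) (M + 1))⁻¹) - 1)) ≤
      w * (ε / 3 + ε / 3) := by gcongr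
  nlinarith

end PartA2

section PartA3
open Filter Topology MeasureTheory Polynomial

section Ring
variable {p : ℕ} [Fact p.Prime]

lemma toZMod_surj : Function.Surjective (PadicInt.toZMod : ℤ_[p] →+* ZMod p) :=
  ZMod.ringHom_surjective _

/-- reduction modulo `p` -/
noncomputable def redR (P : ℤ_[p][X]) :
    AdjoinRoot P →+* AdjoinRoot (P.map (PadicInt.toZMod : ℤ_[p] →+* ZMod p)) :=
  AdjoinRoot.map PadicInt.toZMod P _ dvd_rfl

lemma redR_mk (P f : ℤ_[p][X]) :
    redR P (AdjoinRoot.mk P f) = AdjoinRoot.mk _ (f.map (PadicInt.toZMod : ℤ_[p] →+* ZMod p)) := by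
  induction f using Polynomial.induction_on' with
  | add f g hf hg => simp [hf, hg]
  | monomial n a =>
    rw [← C_mul_X_pow_eq_monomial]
    simp [redR]

lemma redR_surj (P : ℤ_[p][X]) : Function.Surjective (redR P) := by
  intro y
  obtain ⟨g, rfl⟩ := AdjoinRoot.mk_surjective y
  obtain ⟨f, rfl⟩ := Polynomial.map_surjective _ (toZMod_surj (p := p)) g
  exact ⟨AdjoinRoot.mk P f, redR_mk P f⟩

lemma redR_ker (P : ℤ_[p][X]) : RingHom.ker (redR P) = Ideal.span {(p : AdjoinRoot P)} := by
  ext y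
  obtain ⟨f, rfl⟩ := AdjoinRoot.mk_surjective y
  rw [RingHom.mem_ker, redR_mk, AdjoinRoot.mk_eq_zero, Ideal.mem_span_singleton]
  constructor
  · rintro ⟨g, hg⟩
    obtain ⟨g, rfl⟩ := Polynomial.map_surjective _ (toZMod_surj (p := p)) g
    have h1 : C (p : ℤ_[p]) ∣ f - P * g := by
      rw [C_dvd_iff_dvd_coeff]
      intro i
      rw [← Ideal.mem_span_singleton, ← PadicInt.maximalIdeal_eq_span_p, ← PadicInt.ker_toZMod,
        RingHom.mem_ker, ← coeff_map, Polynomial.map_sub, Polynomial.map_mul, hg, sub_self, coeff_zero]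
    obtain ⟨h, hh⟩ := h1
    refine ⟨AdjoinRoot.mk P h, ?_⟩
    have : f = P * g + C (p : ℤ_[p]) * h := by rw [← hh]; ring
    rw [this, map_add, map_mul, AdjoinRoot.mk_self, zero_mul, zero_add, map_mul]
    simp
  · rintro ⟨z, hz⟩
    rw [← AdjoinRoot.mk_eq_zero, ← redR_mk, hz, map_mul, map_natCast]
    have : ((p : ℕ) : AdjoinRoot (P.map (PadicInt.toZMod : ℤ_[p] →+* ZMod p))) = 0 := by
      rw [← map_natCast (AdjoinRoot.of (P.map (PadicInt.toZMod : ℤ_[p] →+* ZMod p)))]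
      simp
    rw [this, zero_mul]

variable {P : ℤ_[p][X]} (hm : P.Monic)
  (hi : Irreducible (P.map (PadicInt.toZMod : ℤ_[p] →+* ZMod p)))

include hm hi

lemma R_isDomain : IsDomain (AdjoinRoot P) := by
  have : Irreducible P := hm.irreducible_of_irreducible_map _ _ hi
  exact AdjoinRoot.isDomain_of_prime this.prime

lemma R_max : (Ideal.span {(p : AdjoinRoot P)}).IsMaximal := by
  haveI := Fact.mk hi
  rw [← redR_ker]
  exact RingHom.ker_isMaximal_of_surjective _ (redR_surj P)

lemma R_unique_max : ∀ I : Ideal (AdjoinRoot P), I.IsMaximal → I = Ideal.span {(p : AdjoinRoot P)} := by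
  intro I hI
  haveI := hm.finite_adjoinRoot
  have h1 : (I.comap (algebraMap ℤ_[p] (AdjoinRoot P))).IsMaximal :=
    Ideal.isMaximal_comap_of_isIntegral_of_isMaximal I
  have h2 := IsLocalRing.eq_maximalIdeal h1
  have h3 : (p : ℤ_[p]) ∈ I.comap (algebraMap ℤ_[p] (AdjoinRoot P)) := by
    rw [h2, PadicInt.maximalIdeal_eq_span_p]; exact Ideal.mem_span_singleton_self _
  rw [Ideal.mem_comap, map_natCast] at h3
  refine ((R_max hm hi).eq_of_le hI.ne_top ?_).symm
  rwa [Ideal.span_singleton_le_iff_mem]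

lemma R_isLocal : IsLocalRing (AdjoinRoot P) :=
  IsLocalRing.of_unique_max_ideal ⟨_, R_max hm hi, R_unique_max hm hi⟩

lemma R_maxIdeal (inst : IsLocalRing (AdjoinRoot P)) :
    IsLocalRing.maximalIdeal (AdjoinRoot P) = Ideal.span {(p : AdjoinRoot P)} :=
  R_unique_max hm hi _ (IsLocalRing.maximalIdeal.isMaximal _)

lemma R_inj : Function.Injective (algebraMap ℤ_[p] (AdjoinRoot P)) := by
  refine AdjoinRoot.of.injective_of_degree_ne_zero ?_
  rw [← hm.degree_map (PadicInt.toZMod : ℤ_[p] →+* ZMod p)]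
  exact hi.degree_pos.ne'

lemma R_p_ne : (p : AdjoinRoot P) ≠ 0 := by
  intro h
  have h2 : algebraMap ℤ_[p] (AdjoinRoot P) (p : ℤ_[p]) = algebraMap ℤ_[p] (AdjoinRoot P) 0 := by
    rw [map_natCast, h, map_zero]
  have := R_inj hm hi h2
  exact (Fact.out : p.Prime).ne_zero (by exact_mod_cast this)

lemma R_dvr : ∃ _ : IsDomain (AdjoinRoot P), IsDiscreteValuationRing (AdjoinRoot P) := by
  haveI := R_isDomain hm hi
  haveI := R_isLocal hm hi
  haveI := hm.finite_adjoinRoot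
  haveI : IsNoetherianRing (AdjoinRoot P) := isNoetherianRing_of_surjective _ _ (AdjoinRoot.mk P)
    AdjoinRoot.mk_surjective
  have hnf : ¬ IsField (AdjoinRoot P) := by
    rw [IsLocalRing.isField_iff_maximalIdeal_eq, R_maxIdeal hm hi inferInstance]
    intro h
    rw [Ideal.span_singleton_eq_bot] at h
    exact R_p_ne hm hi h
  refine ⟨inferInstance, ((IsDiscreteValuationRing.TFAE _ hnf).out 0 4).2 ?_⟩
  rw [R_maxIdeal hm hi inferInstance]
  exact ⟨_, rfl⟩

/-- residue field identification -/
lemma R_res (inst : IsLocalRing (AdjoinRoot P)) :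
    Nat.card (IsLocalRing.ResidueField (AdjoinRoot P)) = p ^ P.natDegree := by
  set Q := P.map (PadicInt.toZMod : ℤ_[p] →+* ZMod p) with hQ
  have hQm : Q.Monic := hm.map _
  have e : IsLocalRing.ResidueField (AdjoinRoot P) ≃+* AdjoinRoot Q :=
    (Ideal.quotEquivOfEq ((R_maxIdeal hm hi inst).trans (redR_ker P).symm)).trans
      (RingHom.quotientKerEquivOfSurjective (redR_surj P))
  haveI := hQm.finite_adjoinRoot
  haveI := hQm.free_adjoinRoot
  rw [Nat.card_congr e.toEquiv, Module.natCard_eq_pow_finrank (K := ZMod p), Nat.card_zmod,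
    (AdjoinRoot.powerBasis' hQm).finrank]
  rw [AdjoinRoot.powerBasis'_dim, hQ, hm.natDegree_map]

lemma R_coprime {P' : ℤ_[p][X]} (hm' : P'.Monic)
    (hi' : Irreducible (P'.map (PadicInt.toZMod : ℤ_[p] →+* ZMod p)))
    (hne : P.map (PadicInt.toZMod : ℤ_[p] →+* ZMod p) ≠ P'.map (PadicInt.toZMod : ℤ_[p] →+* ZMod p)) :
    IsCoprime P P' := by
  haveI := R_isLocal hm hi
  have h1 : IsUnit (AdjoinRoot.mk P P') := by
    by_contra h
    rw [← mem_nonunits_iff, ← IsLocalRing.mem_maximalIdeal, R_maxIdeal hm hi inferInstance,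
      ← redR_ker, RingHom.mem_ker, redR_mk, AdjoinRoot.mk_eq_zero] at h
    have := (hi.dvd_irreducible_iff_associated hi').1 h
    exact hne (eq_of_monic_of_associated (hm.map _) (hm'.map _) this)
  obtain ⟨u, hu⟩ := h1.exists_right_inv
  obtain ⟨g, rfl⟩ := AdjoinRoot.mk_surjective u
  rw [← map_mul, ← map_one (AdjoinRoot.mk P), AdjoinRoot.mk_eq_mk] at hu
  obtain ⟨k, hk⟩ := hu
  exact ⟨-k, g, by linear_combination hk⟩

end Ring

end PartA3

section PartA4
open Filter Topology MeasureTheory Polynomial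

section Classif
variable {R : Type} [CommRing R] [IsDomain R] [IsDiscreteValuationRing R] (p : ℕ)
  (hp : IsLocalRing.maximalIdeal R = Ideal.span {(p : R)})

include hp

lemma dvr_irr : Irreducible (p : R) :=
  (IsDiscreteValuationRing.irreducible_iff_uniformizer _).2 hp

lemma dvr_card (s : ℕ) : Nat.card (R ⧸ Submodule.span R {(p : R) ^ s}) =
    (Nat.card (IsLocalRing.ResidueField R)) ^ s := by
  have h0 : (IsLocalRing.maximalIdeal R) ≠ ⊥ := IsDiscreteValuationRing.not_a_field R
  have := cardQuot_pow_of_prime (P := IsLocalRing.maximalIdeal R) h0 (i := s)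
  rw [Submodule.cardQuot_apply, Submodule.cardQuot_apply] at this
  rw [hp, Ideal.span_singleton_pow, ← hp] at this
  exact this

lemma dvr_tors (k s : ℕ) : Nat.card {y : R ⧸ Submodule.span R {(p : R) ^ k} // (p ^ s : ℕ) • y = 0} =
    (Nat.card (IsLocalRing.ResidueField R)) ^ (min k s) := by
  have hp0 : (p : R) ≠ 0 := (dvr_irr p hp).ne_zero
  rcases le_total k s with h | h
  · rw [min_eq_left h, ← dvr_card p hp]
    refine Nat.card_congr (Equiv.subtypeUnivEquiv fun y => ?_)
    obtain ⟨y, rfl⟩ := Submodule.Quotient.mk_surjective _ y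
    rw [← Submodule.Quotient.mk_smul, Submodule.Quotient.mk_eq_zero, Submodule.mem_span_singleton]
    refine ⟨p ^ (s - k) * y, ?_⟩
    rw [nsmul_eq_mul, smul_eq_mul, mul_right_comm, ← pow_add, Nat.sub_add_cancel h]
    push_cast; ring
  · rw [min_eq_right h, ← dvr_card p hp]
    symm
    let f : (R ⧸ Submodule.span R {(p : R) ^ s}) →ₗ[R] (R ⧸ Submodule.span R {(p : R) ^ k}) :=
      Submodule.mapQ _ _ (LinearMap.lsmul R R ((p : R) ^ (k - s))) (by
        rw [Submodule.span_singleton_le_iff_mem, Submodule.mem_comap, LinearMap.lsmul_apply,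
          smul_eq_mul, ← pow_add, Nat.sub_add_cancel h]
        exact Submodule.mem_span_singleton_self _)
    have hf : ∀ x : R, f (Submodule.Quotient.mk x) = Submodule.Quotient.mk ((p : R) ^ (k - s) * x) :=
      fun x => rfl
    have hinj : Function.Injective f := by
      rw [injective_iff_map_eq_zero]
      intro y hy
      obtain ⟨y, rfl⟩ := Submodule.Quotient.mk_surjective _ y
      rw [hf, Submodule.Quotient.mk_eq_zero, Submodule.mem_span_singleton] at hy
      rw [Submodule.Quotient.mk_eq_zero, Submodule.mem_span_singleton]
      obtain ⟨a, ha⟩ := hy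
      refine ⟨a, mul_left_cancel₀ (pow_ne_zero (k - s) hp0) ?_⟩
      rw [← ha, smul_eq_mul, smul_eq_mul, mul_left_comm, ← pow_add, Nat.sub_add_cancel h]
    refine Nat.card_congr ((Equiv.ofInjective f hinj).trans (Equiv.subtypeEquivRight fun y => ?_))
    obtain ⟨y, rfl⟩ := Submodule.Quotient.mk_surjective _ y
    rw [← Submodule.Quotient.mk_smul, Submodule.Quotient.mk_eq_zero, Submodule.mem_span_singleton]
    constructor
    · rintro ⟨z, hz⟩
      obtain ⟨z, rfl⟩ := Submodule.Quotient.mk_surjective _ z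
      rw [hf, Submodule.Quotient.eq, Submodule.mem_span_singleton] at hz
      obtain ⟨a, ha⟩ := hz
      refine ⟨z - a * p ^ s, ?_⟩
      have e : (p : R) ^ k = p ^ (k - s) * p ^ s := by rw [← pow_add, Nat.sub_add_cancel h]
      rw [smul_eq_mul] at ha ⊢
      rw [nsmul_eq_mul]
      push_cast
      rw [e] at ha ⊢
      linear_combination (-(p : R)^s) * ha
    · rintro ⟨a, ha⟩
      refine ⟨Submodule.Quotient.mk a, ?_⟩
      rw [hf]
      congr 1
      refine mul_left_cancel₀ (pow_ne_zero s hp0) ?_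
      rw [nsmul_eq_mul, smul_eq_mul] at ha
      push_cast at ha
      rw [← ha, ← mul_assoc, ← pow_add, Nat.add_sub_cancel' h, mul_comm]

lemma fin_mod_decomp (M : Type) [AddCommGroup M] [Module R M] [Finite M] :
    ∃ (d : ℕ) (k : Fin d → ℕ),
      Nonempty (M ≃ₗ[R] ((i : Fin d) → R ⧸ Submodule.span R {(p : R) ^ (k i)})) := by
  have hM : Module.IsTorsion' M (Submonoid.powers (p : R)) := by
    intro x
    obtain ⟨a, b, hab, h⟩ := Finite.exists_ne_map_eq_of_infinite (fun n : ℕ => ((p : R) ^ n) • x)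
    wlog hlt : a < b generalizing a b
    · exact this b a hab.symm h.symm (by omega)
    refine ⟨⟨(p : R) ^ a, a, rfl⟩, ?_⟩
    have hu : IsUnit (1 - (p : R) ^ (b - a)) := by
      have : (p : R) ^ (b - a) ∈ IsLocalRing.maximalIdeal R := by
        refine Ideal.pow_mem_of_mem _ ?_ _ (by omega)
        rw [hp]; exact Ideal.mem_span_singleton_self _
      by_contra hn
      have h2 := Ideal.add_mem _ ((IsLocalRing.mem_maximalIdeal _).2 hn) this
      rw [sub_add_cancel] at h2
      exact (IsLocalRing.mem_maximalIdeal _).1 h2 isUnit_one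
    have h3 : (1 - (p : R) ^ (b - a)) • ((p : R) ^ a • x) = 0 := by
      rw [sub_smul, one_smul, smul_smul, ← pow_add, Nat.sub_add_cancel hlt.le]
      exact sub_eq_zero.2 h
    exact (hu.smul_eq_zero).1 h3
  obtain ⟨d, k, ⟨e⟩⟩ := Module.torsion_by_prime_power_decomposition (dvr_irr p hp) hM
  exact ⟨d, k, ⟨e.trans (DirectSum.linearEquivFunOnFintype R (Fin d) _)⟩⟩

lemma tors_card {d : ℕ} (k : Fin d → ℕ) (s : ℕ) :
    Nat.card {x : ((i : Fin d) → R ⧸ Submodule.span R {(p : R) ^ (k i)}) // (p ^ s : ℕ) • x = 0} =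
    (Nat.card (IsLocalRing.ResidueField R)) ^ (∑ i, min (k i) s) := by
  have e : {x : ((i : Fin d) → R ⧸ Submodule.span R {(p : R) ^ (k i)}) // (p ^ s : ℕ) • x = 0} ≃
      ((i : Fin d) → {y : R ⧸ Submodule.span R {(p : R) ^ (k i)} // (p ^ s : ℕ) • y = 0}) :=
    (Equiv.subtypeEquivRight fun x => by rw [funext_iff]; rfl).trans
      (Equiv.subtypePiEquivPi (p := fun i (y : R ⧸ Submodule.span R {(p : R) ^ (k i)}) => (p ^ s : ℕ) • y = 0))
  rw [Nat.card_congr e, Nat.card_pi, ← Finset.prod_pow_eq_pow_sum]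
  exact Finset.prod_congr rfl fun i _ => dvr_tors p hp (k i) s

omit hp [IsDomain R] [IsDiscreteValuationRing R] in
lemma drop_zero {d : ℕ} (k : Fin d → ℕ) :
    Nonempty (((i : Fin d) → R ⧸ Submodule.span R {(p : R) ^ (k i)}) ≃ₗ[R]
      ((i : {i : Fin d // k i ≠ 0}) → R ⧸ Submodule.span R {(p : R) ^ (k i)})) := by
  refine ⟨LinearEquiv.ofBijective (LinearMap.pi fun i => LinearMap.proj i.1) ⟨?_, ?_⟩⟩
  · rw [injective_iff_map_eq_zero]
    intro x hx
    funext i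
    by_cases h : k i = 0
    · obtain ⟨y, hy⟩ := Submodule.Quotient.mk_surjective _ (x i)
      rw [← hy, Pi.zero_apply, Submodule.Quotient.mk_eq_zero, h, pow_zero, Ideal.submodule_span_eq,
        Ideal.span_singleton_one]
      trivial
    · exact congrFun hx ⟨i, h⟩
  · intro y
    refine ⟨fun i => if h : k i ≠ 0 then y ⟨i, h⟩ else 0, ?_⟩
    funext i
    simp [i.2]

lemma equiv_of_addEquiv (hq : 2 ≤ Nat.card (IsLocalRing.ResidueField R))
    (M M' : Type) [AddCommGroup M] [Module R M] [Finite M]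
    [AddCommGroup M'] [Module R M'] (e : M ≃+ M') : Nonempty (M ≃ₗ[R] M') := by
  have : Finite M' := Finite.of_equiv M e.toEquiv
  obtain ⟨d, k, ⟨f⟩⟩ := fin_mod_decomp p hp M
  obtain ⟨d', k', ⟨f'⟩⟩ := fin_mod_decomp p hp M'
  have hS : ∀ s, ∑ i, min (k i) s = ∑ i, min (k' i) s := by
    intro s
    have h1 := tors_card p hp k s
    have h2 := tors_card p hp k' s
    let E := (f.symm.toAddEquiv.trans e).trans f'.toAddEquiv
    have h3 := Nat.card_congr (Equiv.subtypeEquiv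
      (p := fun x => (p ^ s : ℕ) • x = 0) (q := fun x => (p ^ s : ℕ) • x = 0) E.toEquiv (fun a => by
        change _ ↔ (p ^ s : ℕ) • E a = 0
        rw [← map_nsmul, map_eq_zero_iff E E.injective]))
    rw [h1, h2] at h3
    exact Nat.pow_right_injective hq h3
  have hcard : ∀ s, s ≠ 0 → Nat.card {i // k i = s} = Nat.card {i // k' i = s} := by
    intro s hs
    obtain ⟨s, rfl⟩ := Nat.exists_eq_succ_of_ne_zero hs
    have key : ∀ (d : ℕ) (k : Fin d → ℕ), Nat.card {i // k i = s + 1} + ∑ i, min (k i) s +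
        ∑ i, min (k i) (s + 2) = 2 * ∑ i, min (k i) (s + 1) := by
      intro d k
      rw [Nat.card_eq_fintype_card, Fintype.card_subtype, Finset.card_filter, ← Finset.sum_add_distrib,
        ← Finset.sum_add_distrib, Finset.mul_sum]
      refine Finset.sum_congr rfl fun i _ => ?_
      split_ifs with h <;> omega
    have h1 := key d k
    have h2 := key d' k'
    simp only [hS] at h1
    simp only [Nat.succ_eq_add_one]
    omega
  let σ : {i // k i ≠ 0} ≃ {i // k' i ≠ 0} :=
    Equiv.ofFiberEquiv (f := fun i => k i.1) (g := fun i => k' i.1) fun c => by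
      apply Classical.choice
      by_cases hc : c = 0
      · have h1 : IsEmpty {a : {i // k i ≠ 0} // k a.1 = c} := ⟨fun a => a.1.2 (a.2.trans hc)⟩
        have h2 : IsEmpty {a : {i // k' i ≠ 0} // k' a.1 = c} := ⟨fun a => a.1.2 (a.2.trans hc)⟩
        exact ⟨Equiv.equivOfIsEmpty _ _⟩
      · refine ⟨(Equiv.subtypeSubtypeEquivSubtype (q := fun i => k i = c) fun {x} h => h ▸ hc).trans
          ((Classical.choice ((Finite.card_eq (α := {i // k i = c}) (β := {i // k' i = c})).1 (hcard c hc))).trans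
          (Equiv.subtypeSubtypeEquivSubtype (q := fun i => k' i = c) fun {x} h => h ▸ hc).symm)⟩
  have hσ : ∀ i, k' (σ i).1 = k i.1 := fun i => Equiv.ofFiberEquiv_map (f := fun i : {i // k i ≠ 0} => k i.1) (g := fun i : {i // k' i ≠ 0} => k' i.1) _ i
  obtain ⟨g⟩ := drop_zero (R := R) p k
  obtain ⟨g'⟩ := drop_zero (R := R) p k'
  refine ⟨f.trans (g.trans (LinearEquiv.trans (LinearEquiv.piCongrRight fun i => ?_)
    ((LinearEquiv.piCongrLeft R (fun b : {i // k' i ≠ 0} =>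
      R ⧸ Submodule.span R {(p : R) ^ (k' b)}) σ).trans (g'.symm.trans f'.symm))))⟩
  exact Submodule.quotEquivOfEq _ _ (by rw [hσ])

end Classif

end PartA4

section PartA5
open Filter Topology MeasureTheory Polynomial

section Cok
variable {S : Type} [CommRing S] {n : ℕ} (P : S[X]) (X : Fin n → Fin n → S)

/-- columns of `X - t` over `S[t]/(P)` -/
noncomputable def colR (i : Fin n) : Fin n → AdjoinRoot P :=
  fun k => algebraMap S (AdjoinRoot P) (X k i) - Pi.single (M := fun _ => AdjoinRoot P) i (AdjoinRoot.root P) k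

/-- column span -/
noncomputable def colSpan : Submodule (AdjoinRoot P) (Fin n → AdjoinRoot P) :=
  Submodule.span _ (Set.range (colR P X))

/-- base change of vectors -/
noncomputable def bc (n : ℕ) : (Fin n → S) →ₗ[S] (Fin n → AdjoinRoot P) :=
  LinearMap.compLeft (Algebra.linearMap S (AdjoinRoot P)) (Fin n)

lemma bc_apply (v : Fin n → S) (k : Fin n) : bc P n v k = algebraMap S (AdjoinRoot P) (v k) := rfl

lemma bc_single (i : Fin n) : bc P n (Pi.single i 1) = Pi.single i 1 := by
  funext k
  rw [bc_apply]
  by_cases h : k = i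
  · subst h; simp
  · simp [h]

lemma bc_mulVec (v : Fin n → S) :
    bc P n ((Matrix.of X).mulVec v) - AdjoinRoot.root P • bc P n v =
      ∑ i, bc P n v i • colR P X i := by
  funext k
  simp only [Pi.sub_apply, bc_apply, Pi.smul_apply, Finset.sum_apply, smul_eq_mul, colR, mul_sub,
    Finset.sum_sub_distrib, Matrix.mulVec, dotProduct, map_sum, map_mul, Matrix.of_apply]
  congr 1
  · exact Finset.sum_congr rfl fun i _ => mul_comm _ _
  · rw [Finset.sum_eq_single k]
    · simp [mul_comm]
    · intro b _ hb; simp [hb.symm]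
    · simp

noncomputable def thetaR : (Fin n → S) →ₗ[S] ((Fin n → AdjoinRoot P) ⧸ colSpan P X) :=
  ((colSpan P X).mkQ.restrictScalars S).comp (bc P n)

lemma thetaR_mulVec (v : Fin n → S) :
    thetaR P X ((Matrix.of X).mulVec v) = AdjoinRoot.root P • thetaR P X v := by
  rw [← sub_eq_zero]
  change (colSpan P X).mkQ (bc P n ((Matrix.of X).mulVec v)) - AdjoinRoot.root P • (colSpan P X).mkQ (bc P n v) = 0
  rw [← map_smul, ← map_sub, bc_mulVec, Submodule.mkQ_apply, Submodule.Quotient.mk_eq_zero]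
  exact Submodule.sum_mem _ fun i _ => Submodule.smul_mem _ _ (Submodule.subset_span ⟨i, rfl⟩)

lemma thetaR_aeval (f : S[X]) : ∀ (v : Fin n → S),
    thetaR P X ((aeval (Matrix.of X) f).mulVec v) = AdjoinRoot.mk P f • thetaR P X v := by
  induction f using Polynomial.induction_on with
  | C a =>
    intro v
    rw [aeval_C, Algebra.algebraMap_eq_smul_one, Matrix.smul_mulVec, Matrix.one_mulVec, map_smul,
      AdjoinRoot.mk_C, ← AdjoinRoot.algebraMap_eq, algebraMap_smul]
  | add f g hf hg => intro v; rw [map_add, Matrix.add_mulVec, map_add, hf, hg, map_add, add_smul]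
  | monomial n a ih =>
    intro v
    rw [pow_succ, ← mul_assoc, map_mul, aeval_X, ← Matrix.mulVec_mulVec, ih, thetaR_mulVec,
      smul_smul, map_mul (AdjoinRoot.mk P) (C a * Polynomial.X ^ n) Polynomial.X, AdjoinRoot.mk_X]

lemma pi_eq_sum_single {R : Type} [CommRing R] (y : Fin n → R) :
    y = ∑ i, y i • (Pi.single i 1 : Fin n → R) := by
  simpa using (pi_eq_sum_univ' y)

lemma thetaR_surj : Function.Surjective (thetaR P X) := by
  intro y
  obtain ⟨y, rfl⟩ := Submodule.Quotient.mk_surjective _ y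
  choose f hf using fun i => AdjoinRoot.mk_surjective (y i)
  refine ⟨∑ i, (aeval (Matrix.of X) (f i)).mulVec (Pi.single i 1), ?_⟩
  rw [map_sum]
  conv_rhs => rw [pi_eq_sum_single y]
  rw [← Submodule.mkQ_apply, map_sum]
  refine Finset.sum_congr rfl fun i _ => ?_
  rw [thetaR_aeval, hf, map_smul]
  congr 1
  change (colSpan P X).mkQ (bc P n (Pi.single i 1)) = _
  rw [bc_single]

noncomputable def EvP (g : Fin n → S[X]) : Fin n → S :=
  ∑ k, (aeval (Matrix.of X) (g k)).mulVec (Pi.single k 1)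

lemma thetaR_ker : LinearMap.ker (thetaR P X) =
    LinearMap.range (aeval (Matrix.of X) P).mulVecLin := by
  ext x
  rw [LinearMap.mem_ker]
  constructor
  · intro hx
    change (colSpan P X).mkQ (bc P n x) = 0 at hx
    rw [Submodule.mkQ_apply, Submodule.Quotient.mk_eq_zero, colSpan,
      Submodule.mem_span_range_iff_exists_fun] at hx
    obtain ⟨a, ha⟩ := hx
    choose f hf using fun i => AdjoinRoot.mk_surjective (a i)
    have h1 : ∀ k, ∃ b, C (x k) = ∑ i, f i * (C (X k i) - if k = i then Polynomial.X else 0) + P * b := by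
      intro k
      have h2 : AdjoinRoot.mk P (C (x k)) =
          AdjoinRoot.mk P (∑ i, f i * (C (X k i) - if k = i then Polynomial.X else 0)) := by
        have := congrFun ha k
        rw [bc_apply] at this
        rw [AdjoinRoot.mk_C, ← AdjoinRoot.algebraMap_eq, ← this, Finset.sum_apply, map_sum]
        refine Finset.sum_congr rfl fun i _ => ?_
        rw [map_mul, hf, Pi.smul_apply, smul_eq_mul, map_sub, AdjoinRoot.mk_C, colR,
          ← AdjoinRoot.algebraMap_eq]
        congr 2
        by_cases h : k = i
        · subst h; simp
        · simp [h]
      rw [AdjoinRoot.mk_eq_mk] at h2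
      obtain ⟨b, hb⟩ := h2
      exact ⟨b, by linear_combination hb⟩
    choose b hb using h1
    refine ⟨EvP X b, ?_⟩
    rw [Matrix.mulVecLin_apply]
    have e1 : EvP X (fun k => C (x k)) = x := by
      rw [EvP]
      conv_rhs => rw [pi_eq_sum_single x]
      refine Finset.sum_congr rfl fun i _ => ?_
      rw [aeval_C, Algebra.algebraMap_eq_smul_one, Matrix.smul_mulVec, Matrix.one_mulVec]
    have e2 : EvP X (fun k => P * b k) = (aeval (Matrix.of X) P).mulVec (EvP X b) := by
      rw [EvP, EvP, Matrix.mulVec_sum]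
      refine Finset.sum_congr rfl fun i _ => ?_
      rw [map_mul, Matrix.mulVec_mulVec]
    have e3 : EvP X (fun k => ∑ i, f i * (C (X k i) - if k = i then Polynomial.X else 0)) = 0 := by
      simp only [EvP, map_sum, Matrix.sum_mulVec]
      rw [Finset.sum_comm]
      refine Finset.sum_eq_zero fun i _ => ?_
      have : ∀ k, (aeval (Matrix.of X) (f i * (C (X k i) - if k = i then Polynomial.X else 0))).mulVec
          (Pi.single k 1) = (aeval (Matrix.of X) (f i)).mulVec (X k i • (Pi.single k 1) -
            if k = i then (Matrix.of X).mulVec (Pi.single k 1) else 0) := by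
        intro k
        rw [map_mul, ← Matrix.mulVec_mulVec]
        congr 1
        rw [map_sub, Matrix.sub_mulVec, aeval_C, Algebra.algebraMap_eq_smul_one, Matrix.smul_mulVec,
          Matrix.one_mulVec]
        split_ifs with h
        · rw [aeval_X]
        · rw [map_zero, Matrix.zero_mulVec]
      simp only [this]
      rw [← Matrix.mulVec_sum, Finset.sum_sub_distrib]
      have h3 : ∑ k, X k i • (Pi.single k 1 : Fin n → S) = (Matrix.of X).mulVec (Pi.single i 1) := by
        rw [Matrix.mulVec_single_one]
        exact (pi_eq_sum_single (fun k => X k i)).symm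
      rw [h3]
      simp
    rw [← e2]
    conv_rhs => rw [← e1]
    simp only [hb]
    have : EvP X (fun k => ∑ i, f i * (C (X k i) - if k = i then Polynomial.X else 0) + P * b k) =
      EvP X (fun k => ∑ i, f i * (C (X k i) - if k = i then Polynomial.X else 0)) +
        EvP X (fun k => P * b k) := by
      simp only [EvP, map_add, Matrix.add_mulVec, Finset.sum_add_distrib]
    rw [this, e3, zero_add]
  · rintro ⟨v, rfl⟩
    rw [Matrix.mulVecLin_apply, thetaR_aeval, AdjoinRoot.mk_self, zero_smul]

lemma cok_equiv : Nonempty (((Fin n → S) ⧸ LinearMap.range (aeval (Matrix.of X) P).mulVecLin) ≃+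
    ((Fin n → AdjoinRoot P) ⧸ colSpan P X)) :=
  ⟨((Submodule.quotEquivOfEq _ _ (thetaR_ker P X).symm).trans
    (LinearMap.quotKerEquivOfSurjective _ (thetaR_surj P X))).toAddEquiv⟩

end Cok

end PartA5

section PartA6
open Filter Topology MeasureTheory Polynomial


section Mom
variable {p : ℕ} [Fact p.Prime]

lemma zp_div {N : ℕ} (hN : N ≠ 0) : ∃ b : ℕ, ∀ x : ℤ_[p],
    x ∈ Ideal.span {(p : ℤ_[p]) ^ b} → ∃ y, x = (N : ℤ_[p]) * y := by
  have h0 : (N : ℤ_[p]) ≠ 0 := Nat.cast_ne_zero.2 hN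
  refine ⟨(N : ℤ_[p]).valuation, fun x hx => ?_⟩
  obtain ⟨y, rfl⟩ := Ideal.mem_span_singleton'.1 hx
  have h := PadicInt.unitCoeff_spec h0
  refine ⟨y * ((PadicInt.unitCoeff h0)⁻¹ : ℤ_[p]ˣ), ?_⟩
  have : ((PadicInt.unitCoeff h0 : ℤ_[p]ˣ) : ℤ_[p]) * ((PadicInt.unitCoeff h0)⁻¹ : ℤ_[p]ˣ) = 1 :=
    Units.mul_inv _
  linear_combination (-y * (p : ℤ_[p]) ^ (N : ℤ_[p]).valuation) * this - (y * ((PadicInt.unitCoeff h0)⁻¹ : ℤ_[p]ˣ)) * h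

lemma zp_appr {N : ℕ} (hN : N ≠ 0) (x : ℤ_[p]) : ∃ (m : ℕ) (y : ℤ_[p]), x = m + N * y := by
  obtain ⟨b, hb⟩ := zp_div (p := p) hN
  obtain ⟨y, hy⟩ := hb _ (PadicInt.appr_spec b x)
  exact ⟨x.appr b, y, by linear_combination hy⟩

variable {ι : Type} [Fintype ι] [DecidableEq ι] {P : ι → ℤ_[p][X]} {H : ι → Type} [∀ j, AddCommGroup (H j)]
  [∀ j, Module (AdjoinRoot (P j)) (H j)] [∀ j, Finite (H j)]

lemma zs_mem (N : AddSubgroup (∀ j, H j)) {h : ∀ j, H j} (hh : h ∈ N) (x : ℤ_[p]) :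
    (fun j => algebraMap ℤ_[p] (AdjoinRoot (P j)) x • h j) ∈ N := by
  obtain ⟨m, y, rfl⟩ := zp_appr (p := p) (N := Nat.card (∀ j, H j)) Nat.card_pos.ne' x
  have : (fun j => algebraMap ℤ_[p] (AdjoinRoot (P j)) (m + Nat.card (∀ j, H j) * y) • h j) = m • h := by
    have h2 : Nat.card (∀ j, H j) • (fun j => algebraMap ℤ_[p] (AdjoinRoot (P j)) y • h j) = 0 :=
      card_nsmul_eq_zero'
    funext j
    have h3 := congrFun h2 j
    simp only [Pi.smul_apply, Pi.zero_apply] at h3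
    rw [map_add, map_natCast, map_mul, map_natCast, add_smul, mul_smul, Nat.cast_smul_eq_nsmul,
      Nat.cast_smul_eq_nsmul, h3, add_zero, Pi.smul_apply]
  rw [this]
  exact N.nsmul_mem hh m

variable {n : ℕ}

/-- event -/
def Ev (P : ι → ℤ_[p][X]) {H : ι → Type} [∀ j, AddCommGroup (H j)]
  [∀ j, Module (AdjoinRoot (P j)) (H j)] (h : ∀ j, Fin n → H j) : Set (Fin n → Fin n → ℤ_[p]) :=
  {X | ∀ j i, ∑ k, algebraMap ℤ_[p] (AdjoinRoot (P j)) (X k i) • h j k = AdjoinRoot.root (P j) • h j i}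

/-- generation -/
def Gen (h : ∀ j, Fin n → H j) : Prop :=
  AddSubgroup.closure (Set.range fun k j => h j k) = (⊤ : AddSubgroup (∀ j, H j))

lemma Ev_gen (hP : Pairwise (Function.onFun IsCoprime P)) (h : ∀ j, Fin n → H j)
    (hs : ∀ j, Submodule.span (AdjoinRoot (P j)) (Set.range (h j)) = ⊤)
    {X : Fin n → Fin n → ℤ_[p]} (hX : X ∈ Ev P h) : Gen h := by
  set N := AddSubgroup.closure (Set.range fun k j => h j k) with hN
  have hgen : ∀ k, (fun j => h j k) ∈ N := fun k => AddSubgroup.subset_closure ⟨k, rfl⟩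
  have hT : ∀ y ∈ N, (fun j => AdjoinRoot.root (P j) • y j) ∈ N := by
    intro y hy
    induction hy using AddSubgroup.closure_induction with
    | mem x hx =>
      obtain ⟨i, rfl⟩ := hx
      have : (fun j => AdjoinRoot.root (P j) • h j i) =
          ∑ k, (fun j => algebraMap ℤ_[p] (AdjoinRoot (P j)) (X k i) • h j k) := by
        funext j
        rw [Finset.sum_apply]
        exact (hX j i).symm
      change (fun j => AdjoinRoot.root (P j) • h j i) ∈ N
      rw [this]
      exact N.sum_mem fun k _ => zs_mem N (hgen k) _
    | zero => simp only [Pi.zero_apply, smul_zero]; exact N.zero_mem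
    | add x y _ _ hx hy => simpa [smul_add] using! N.add_mem hx hy
    | neg x _ hx => simp only [Pi.neg_apply, smul_neg]; exact N.neg_mem hx
  have hf : ∀ f : ℤ_[p][X], ∀ y ∈ N, (fun j => AdjoinRoot.mk (P j) f • y j) ∈ N := by
    intro f
    induction f using Polynomial.induction_on with
    | C a =>
      intro y hy
      exact zs_mem N hy a
    | add f g hf hg =>
      intro y hy
      simpa [add_smul] using! N.add_mem (hf y hy) (hg y hy)
    | monomial n a ih =>
      intro y hy
      have := hT _ (ih y hy)
      convert this using 2 with j
      rw [smul_smul, pow_succ, ← mul_assoc, map_mul, AdjoinRoot.mk_X, mul_comm]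
  have hc : ∀ c : ∀ j, AdjoinRoot (P j), ∀ y ∈ N, (fun j => c j • y j) ∈ N := by
    intro c y hy
    choose g hg using fun j => AdjoinRoot.mk_surjective (c j)
    obtain ⟨f, hf'⟩ := Ideal.exists_forall_sub_mem_ideal (I := fun j => Ideal.span {P j})
      (fun i j hij => Ideal.isCoprime_span_singleton_iff _ _ |>.2 (hP hij)) g
    convert hf f y hy using 2 with j
    congr 1
    rw [← hg, eq_comm, AdjoinRoot.mk_eq_mk]
    exact Ideal.mem_span_singleton.1 (hf' j)
  have hsing : ∀ j, ∀ x : H j, Pi.single j x ∈ N := by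
    intro j x
    have hx : x ∈ Submodule.span (AdjoinRoot (P j)) (Set.range (h j)) := by rw [hs]; trivial
    rw [Submodule.mem_span_range_iff_exists_fun] at hx
    obtain ⟨c, rfl⟩ := hx
    have : Pi.single j (∑ i, c i • h j i) = ∑ i, (fun j' =>
        (Pi.single j (c i) : ∀ j, AdjoinRoot (P j)) j' • h j' i) := by
      funext j'
      rw [Finset.sum_apply]
      by_cases hj : j' = j
      · subst hj; simp
      · simp [hj]
    rw [this]
    exact N.sum_mem fun i _ => hc _ _ (hgen i)
  rw [Gen, eq_top_iff]
  intro y _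
  rw [← Finset.univ_sum_single y]
  exact N.sum_mem fun j _ => hsing j _

/-- the evaluation map -/
noncomputable def Psi (P : ι → ℤ_[p][X]) {H : ι → Type} [∀ j, AddCommGroup (H j)]
  [∀ j, Module (AdjoinRoot (P j)) (H j)] (h : ∀ j, Fin n → H j) :
    (Fin n → Fin n → ℤ_[p]) →+ (Fin n → ∀ j, H j) where
  toFun X := fun i j => ∑ k, algebraMap ℤ_[p] (AdjoinRoot (P j)) (X k i) • h j k
  map_zero' := by funext i j; simp
  map_add' X Y := by funext i j; simp [add_smul, Finset.sum_add_distrib]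

lemma Psi_surj (h : ∀ j, Fin n → H j) (hg : Gen h) : Function.Surjective (Psi P h) := by
  let ψ : (Fin n → ℤ_[p]) →+ (∀ j, H j) :=
    { toFun := fun x j => ∑ k, algebraMap ℤ_[p] (AdjoinRoot (P j)) (x k) • h j k
      map_zero' := by funext j; simp
      map_add' := fun X Y => by funext j; simp [add_smul, Finset.sum_add_distrib] }
  have h1 : ψ.range = ⊤ := by
    rw [eq_top_iff, ← hg, AddSubgroup.closure_le]
    rintro _ ⟨k, rfl⟩
    refine ⟨Pi.single k 1, ?_⟩
    funext j
    change ∑ k', algebraMap ℤ_[p] (AdjoinRoot (P j)) ((Pi.single k 1 : Fin n → ℤ_[p]) k') • h j k' = _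
    rw [Finset.sum_eq_single k]
    · simp
    · intro b _ hb; simp [hb]
    · simp
  intro y
  choose x hx using fun i => (AddMonoidHom.range_eq_top.1 h1) (y i)
  exact ⟨fun k i => x i k, funext hx⟩

instance : BorelSpace ℤ_[p] := ⟨rfl⟩

lemma Psi_ker_meas (h : ∀ j, Fin n → H j) :
    MeasurableSet ((Psi P h).ker : Set (Fin n → Fin n → ℤ_[p])) := by
  refine IsOpen.measurableSet ?_
  obtain ⟨b, hb⟩ := zp_div (p := p) (N := Nat.card (∀ j, H j)) Nat.card_pos.ne'
  refine AddSubgroup.isOpen_of_mem_nhds _ (g := 0) ?_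
  have hp0 : (0 : ℝ) < (p : ℝ) := by exact_mod_cast (Fact.out : p.Prime).pos
  have hpos : (0 : ℝ) < (p : ℝ) ^ (-b : ℤ) := zpow_pos hp0 _
  refine Filter.mem_of_superset (Metric.ball_mem_nhds _ hpos) ?_
  intro X hX
  rw [mem_ball_zero_iff, pi_norm_lt_iff hpos] at hX
  change Psi P h X = 0
  funext i j
  change ∑ k, algebraMap ℤ_[p] (AdjoinRoot (P j)) (X k i) • h j k = 0
  refine Finset.sum_eq_zero fun k _ => ?_
  have h1 := (pi_norm_lt_iff hpos).1 (hX k) i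
  obtain ⟨y, hy⟩ := hb _ ((PadicInt.norm_le_pow_iff_mem_span_pow _ _).1 h1.le)
  have h2 : Nat.card (∀ j, H j) • (fun j => algebraMap ℤ_[p] (AdjoinRoot (P j)) y • h j k) = 0 :=
      card_nsmul_eq_zero'
  have h3 := congrFun h2 j
  simp only [Pi.smul_apply, Pi.zero_apply] at h3
  rw [hy, map_mul, map_natCast, mul_smul, Nat.cast_smul_eq_nsmul, h3]

lemma Ev_eq_fibre (h : ∀ j, Fin n → H j) :
    Ev P h = Psi P h ⁻¹' {fun i j => AdjoinRoot.root (P j) • h j i} := by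
  ext X
  simp only [Ev, Set.mem_setOf_eq, Set.mem_preimage, Set.mem_singleton_iff]
  constructor
  · intro hX; funext i j; exact hX j i
  · intro hX j i; exact congrFun (congrFun hX i) j

lemma Ev_empty_or (h : ∀ j, Fin n → H j) : Ev P h = ∅ ∨ ∃ X, Ev P h =
    (fun Y => -X + Y) ⁻¹' ((Psi P h).ker : Set (Fin n → Fin n → ℤ_[p])) := by
  rw [Ev_eq_fibre]
  rcases Set.eq_empty_or_nonempty (Psi P h ⁻¹' {fun i j => AdjoinRoot.root (P j) • h j i}) with h1 | ⟨X, hX⟩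
  · exact Or.inl h1
  · refine Or.inr ⟨X, ?_⟩
    ext Y
    have hX' : Psi P h X = _ := hX
    simp only [Set.mem_preimage, Set.mem_singleton_iff, SetLike.mem_coe, AddMonoidHom.mem_ker,
      map_add, map_neg, hX', neg_add_eq_zero]
    exact eq_comm

lemma Ev_meas (h : ∀ j, Fin n → H j) : MeasurableSet (Ev P h) := by
  rcases Ev_empty_or (P := P) h with h1 | ⟨X, h1⟩
  · rw [h1]; exact MeasurableSet.empty
  · rw [h1]; exact (measurable_const_add (-X)) (Psi_ker_meas h)

lemma Ev_real (μ : Measure (Fin n → Fin n → ℤ_[p])) [IsProbabilityMeasure μ] [μ.IsAddHaarMeasure]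
    (h : ∀ j, Fin n → H j) (hg : Gen h) :
    μ.real (Ev P h) = (((∏ j, Nat.card (H j) : ℕ) : ℝ) ^ n)⁻¹ := by
  have hne : Ev P h ≠ ∅ := by
    rw [Ev_eq_fibre]
    obtain ⟨X, hX⟩ := Psi_surj (P := P) h hg (fun i j => AdjoinRoot.root (P j) • h j i)
    exact Set.Nonempty.ne_empty ⟨X, hX⟩
  rcases Ev_empty_or (P := P) h with h1 | ⟨X, h1⟩
  · exact absurd h1 hne
  have hidx : (Psi P h).ker.index = (∏ j, Nat.card (H j)) ^ n := by
    rw [AddSubgroup.index_ker, AddMonoidHom.range_eq_top.2 (Psi_surj h hg)]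
    rw [AddSubgroup.card_top, Nat.card_fun, Nat.card_pi, Nat.card_fin]
  haveI : (Psi P h).ker.FiniteIndex := ⟨by
    rw [hidx]; exact pow_ne_zero _ (Finset.prod_ne_zero_iff.2 fun j _ => Nat.card_pos.ne')⟩
  have := AddSubgroup.index_mul_measure (Psi P h).ker (Psi_ker_meas h) μ
  rw [measure_univ, hidx] at this
  have h2 := congrArg ENNReal.toReal this
  rw [ENNReal.toReal_mul] at h2
  rw [h1, measureReal_def, measure_preimage_add]
  refine eq_inv_of_mul_eq_one_right ?_
  simpa using h2

end Mom

end PartA6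

section PartA7
open Filter Topology MeasureTheory Polynomial

lemma fin_hom (R : Type) [CommRing R] (M : Type) [AddCommGroup M] [Module R M] [Module.Finite R M]
    (V : Type) [AddCommGroup V] [Module R V] [Finite V] : Finite (M →ₗ[R] V) := by
  obtain ⟨s, hs⟩ := (Module.finite_def.1 ‹Module.Finite R M›)
  refine Finite.of_injective (β := s → V) (fun φ x => φ x) ?_
  intro φ ψ h
  exact LinearMap.ext_on hs fun x hx => congrFun h ⟨x, hx⟩

section Lin
variable (R : Type) [CommRing R] [IsLocalRing R] [Finite (IsLocalRing.ResidueField R)]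
  (M : Type) [AddCommGroup M] [Module R M] [Module.Finite R M]

lemma surj_iff_indep (m : ℕ) (Φ : M →ₗ[R] (Fin m → IsLocalRing.ResidueField R)) :
    Function.Surjective Φ ↔ LinearIndependent (IsLocalRing.ResidueField R)
      (fun i => (LinearMap.proj i).comp Φ : Fin m → (M →ₗ[R] IsLocalRing.ResidueField R)) := by
  constructor
  · intro h
    rw [Fintype.linearIndependent_iff]
    intro g hg i
    obtain ⟨x, hx⟩ := h (Pi.single i 1)
    have := LinearMap.congr_fun hg x
    simp only [LinearMap.sum_apply, LinearMap.smul_apply, LinearMap.comp_apply, hx,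
      LinearMap.proj_apply, LinearMap.zero_apply, smul_eq_mul] at this
    rw [Finset.sum_eq_single i] at this
    · simpa using this
    · intro b _ hb; simp [hb]
    · simp
  · intro h
    by_contra hns
    let N : Submodule (IsLocalRing.ResidueField R) (Fin m → IsLocalRing.ResidueField R) :=
      { carrier := Set.range Φ
        add_mem' := by rintro _ _ ⟨x, rfl⟩ ⟨y, rfl⟩; exact ⟨x + y, map_add _ _ _⟩
        zero_mem' := ⟨0, map_zero _⟩
        smul_mem' := by
          rintro c _ ⟨x, rfl⟩
          obtain ⟨r, rfl⟩ := IsLocalRing.residue_surjective c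
          refine ⟨r • x, ?_⟩
          rw [map_smul]
          funext i
          simp only [Pi.smul_apply]
          rw [Algebra.smul_def, smul_eq_mul]; rfl }
    obtain ⟨v, hv⟩ := not_forall.1 hns
    have hvN : v ∉ N := hv
    obtain ⟨f, hf, hN⟩ := Submodule.exists_le_ker_of_notMem hvN
    rw [Fintype.linearIndependent_iff] at h
    have h1 : ∀ y, f y = ∑ i, f (Pi.single i 1) * y i := by
      intro y
      conv_lhs => rw [pi_eq_sum_univ' y]
      rw [map_sum]
      refine Finset.sum_congr rfl fun i _ => ?_
      rw [map_smul, smul_eq_mul, mul_comm]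
    have h2 := h (fun i => f (Pi.single i 1)) (by
      ext x
      have h3 : f (Φ x) = 0 := hN ⟨x, rfl⟩
      rw [h1] at h3
      simpa using h3)
    exact hf (by rw [h1]; exact Finset.sum_eq_zero fun i _ => by rw [h2 i, zero_mul])

/-- residual rank -/
noncomputable def rkR : ℕ := Module.finrank (IsLocalRing.ResidueField R) (M →ₗ[R] IsLocalRing.ResidueField R)

lemma card_surj (m : ℕ) :
    (Nat.card {Φ : M →ₗ[R] (Fin m → IsLocalRing.ResidueField R) // Function.Surjective Φ} : ℝ) =
      sfun (Nat.card (IsLocalRing.ResidueField R)) m (rkR R M) := by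
  haveI : Finite (M →ₗ[R] IsLocalRing.ResidueField R) := fin_hom R M _
  haveI : Fintype (IsLocalRing.ResidueField R) := Fintype.ofFinite _
  haveI : Fintype (M →ₗ[R] IsLocalRing.ResidueField R) := Fintype.ofFinite _
  have e : {Φ : M →ₗ[R] (Fin m → IsLocalRing.ResidueField R) // Function.Surjective Φ} ≃
      {s : Fin m → (M →ₗ[R] IsLocalRing.ResidueField R) //
        LinearIndependent (IsLocalRing.ResidueField R) s} :=
    { toFun := fun Φ => ⟨_, (surj_iff_indep R M m Φ.1).1 Φ.2⟩
      invFun := fun s => ⟨LinearMap.pi s.1, (surj_iff_indep R M m _).2 s.2⟩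
      left_inv := fun Φ => by ext; rfl
      right_inv := fun s => by ext; rfl }
  rw [Nat.card_congr e]
  by_cases hk : m ≤ rkR R M
  · rw [card_linearIndependent hk, sfun, Nat.cast_prod, Finset.prod_range]
    refine Finset.prod_congr rfl fun i _ => ?_
    rw [← rkR, Nat.cast_sub (Nat.pow_le_pow_right Fintype.card_pos (i.2.le.trans hk))]
    simp
  · rw [sfun_eq_zero _ (not_le.1 hk)]
    haveI : IsEmpty {s : Fin m → (M →ₗ[R] IsLocalRing.ResidueField R) //
        LinearIndependent (IsLocalRing.ResidueField R) s} := ⟨fun s => hk (by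
          simpa [rkR] using s.2.fintype_card_le_finrank)⟩
    simp

lemma rkR_eq_zero : rkR R M = 0 ↔ Subsingleton M := by
  haveI : Finite (M →ₗ[R] IsLocalRing.ResidueField R) := fin_hom R M _
  rw [rkR, Module.finrank_zero_iff]
  constructor
  · intro h
    by_contra hM
    rw [not_subsingleton_iff_nontrivial] at hM
    obtain ⟨N, hN⟩ := IsCoatomic.exists_coatom (Submodule R M)
    have hs := (isSimpleModule_iff_isCoatom (R := R)).2 hN
    obtain ⟨I, hI, ⟨e⟩⟩ := isSimpleModule_iff_quot_maximal.mp hs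
    obtain rfl := IsLocalRing.eq_maximalIdeal hI
    have : N.mkQ = 0 := by
      have h0 : (e.toLinearMap.comp N.mkQ : M →ₗ[R] IsLocalRing.ResidueField R) = 0 := h.elim _ _
      ext x
      apply e.injective
      simpa using! LinearMap.congr_fun h0 x
    have h3 := Submodule.ker_mkQ N
    rw [this, LinearMap.ker_zero] at h3
    exact hN.1 h3.symm
  · intro h
    exact ⟨fun f g => by ext x; rw [Subsingleton.elim x 0, map_zero, map_zero]⟩

end Lin

section Free
variable {R : Type} [CommRing R] [IsDomain R] [IsPrincipalIdealRing R] [CharZero R] {n : ℕ}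
  (K : Submodule R (Fin n → R)) [Finite ((Fin n → R) ⧸ K)]

lemma card_hom (V : Type) [AddCommGroup V] [Module R V] :
    Nat.card (K →ₗ[R] V) = (Nat.card V) ^ n := by
  obtain ⟨m, ⟨b⟩⟩ := Submodule.nonempty_basis_of_pid (Pi.basisFun R (Fin n)) K
  have hm : m = n := by
    have h1 : Module.finrank R K = m := by simpa using Module.finrank_eq_card_basis b
    haveI := Module.Free.of_basis b
    haveI := Module.Finite.of_basis b
    have h2 : Module.finrank R (Fin n → R) = n := by simp
    apply le_antisymm
    · rw [← h1]; conv_rhs => rw [← h2]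
      exact Submodule.finrank_le K
    · rw [← h1]; conv_lhs => rw [← h2]
      have hN : Nat.card ((Fin n → R) ⧸ K) ≠ 0 := Nat.card_pos.ne'
      let f : (Fin n → R) →ₗ[R] K := LinearMap.codRestrict K
        (LinearMap.lsmul R (Fin n → R) (Nat.card ((Fin n → R) ⧸ K) : R)) (by
          intro x
          rw [LinearMap.lsmul_apply, ← Submodule.Quotient.mk_eq_zero, Submodule.Quotient.mk_smul,
            Nat.cast_smul_eq_nsmul]
          exact card_nsmul_eq_zero')
      refine LinearMap.finrank_le_finrank_of_injective (f := f) ?_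
      intro x y hxy
      have := congrArg Subtype.val hxy
      change (Nat.card ((Fin n → R) ⧸ K) : R) • x = (Nat.card ((Fin n → R) ⧸ K) : R) • y at this
      exact smul_right_injective _ (Nat.cast_ne_zero.2 hN) this
  subst hm
  rw [← Nat.card_congr (b.constr R (M' := V)).toEquiv, Nat.card_fun, Nat.card_fin]

end Free

end PartA7

section PartA8
open Filter Topology MeasureTheory Polynomial

lemma bad_count {A V I : Type} [AddCommGroup A] [AddCommGroup V] [Finite A] [Finite V] [Fintype I]
    (T : A →+ (I → V)) (hT : Function.Surjective T) :
    Nat.card {a // AddSubgroup.closure (Set.range (T a)) ≠ ⊤} * 2 ^ Fintype.card I ≤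
      Nat.card (AddSubgroup V) * Nat.card A := by
  classical
  haveI := Fintype.ofFinite A
  haveI : Fintype (AddSubgroup V) := Fintype.ofFinite _
  have h1 : (Finset.univ.filter fun a : A => AddSubgroup.closure (Set.range (T a)) ≠ ⊤) ⊆
      (Finset.univ.filter fun N : AddSubgroup V => N ≠ ⊤).biUnion
        fun N => Finset.univ.filter fun a => ∀ i, T a i ∈ N := by
    intro a ha
    simp only [Finset.mem_filter, Finset.mem_univ, true_and] at ha
    simp only [Finset.mem_biUnion, Finset.mem_filter, Finset.mem_univ, true_and]
    exact ⟨_, ha, fun i => AddSubgroup.subset_closure ⟨i, rfl⟩⟩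
  have h2 : ∀ N : AddSubgroup V, N ≠ ⊤ →
      (Finset.univ.filter fun a => ∀ i, T a i ∈ N).card * 2 ^ Fintype.card I ≤ Nat.card A := by
    intro N hN
    let W : AddSubgroup (I → V) := AddSubgroup.pi Set.univ (fun _ => N)
    have hidx : (W.comap T).index = N.index ^ Fintype.card I := by
      rw [AddSubgroup.index_comap_of_surjective _ hT]
      have := Nat.card_fun (α := I) (β := V)
      have hW : Nat.card W = Nat.card N ^ Nat.card I := by
        rw [← Nat.card_fun]
        refine Nat.card_congr
          { toFun := fun w i => ⟨w.1 i, w.2 i trivial⟩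
            invFun := fun f => ⟨fun i => (f i).1, fun i _ => (f i).2⟩
            left_inv := fun w => rfl
            right_inv := fun w => rfl }
      have h3 := W.card_mul_index
      rw [hW, Nat.card_fun, ← N.card_mul_index, mul_pow] at h3
      have := Nat.eq_of_mul_eq_mul_left (pow_pos Nat.card_pos _) h3
      rw [this, Nat.card_eq_fintype_card]
    have h4 := (W.comap T).card_mul_index
    have h5 : Nat.card (W.comap T) = (Finset.univ.filter fun a => ∀ i, T a i ∈ N).card := by
      rw [← Fintype.card_subtype, ← Nat.card_eq_fintype_card]
      refine Nat.card_congr (Equiv.subtypeEquivRight fun a => ?_)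
      simp [W, AddSubgroup.mem_pi]
    rw [← h4, h5, hidx]
    exact Nat.mul_le_mul_left _ (Nat.pow_le_pow_left (AddSubgroup.one_lt_index_of_ne_top hN) _)
  rw [Nat.card_eq_fintype_card, Fintype.card_subtype]
  calc _ ≤ (∑ N ∈ (Finset.univ.filter fun N : AddSubgroup V => N ≠ ⊤),
        (Finset.univ.filter fun a => ∀ i, T a i ∈ N).card) * 2 ^ Fintype.card I :=
        Nat.mul_le_mul_right _ ((Finset.card_le_card h1).trans Finset.card_biUnion_le)
    _ = ∑ N ∈ (Finset.univ.filter fun N : AddSubgroup V => N ≠ ⊤),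
        (Finset.univ.filter fun a => ∀ i, T a i ∈ N).card * 2 ^ Fintype.card I := Finset.sum_mul _ _ _
    _ ≤ ∑ N ∈ (Finset.univ.filter fun N : AddSubgroup V => N ≠ ⊤), Nat.card A :=
        Finset.sum_le_sum fun N hN => h2 N (Finset.mem_filter.1 hN).2
    _ ≤ _ := by
        rw [Finset.sum_const, smul_eq_mul, Nat.card_eq_fintype_card (α := AddSubgroup V)]
        exact Nat.mul_le_mul_right _ (Finset.card_filter_le _ _)

end PartA8

section PartA9
open Filter Topology MeasureTheory Polynomial

lemma card_kill (R : Type) [CommRing R] [IsLocalRing R] [Finite (IsLocalRing.ResidueField R)]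
    (M : Type) [AddCommGroup M] [Module R M] [Module.Finite R M] (C : Submodule R M) (m : ℕ) :
    (Nat.card {Φ : M →ₗ[R] (Fin m → IsLocalRing.ResidueField R) //
      Function.Surjective Φ ∧ C ≤ LinearMap.ker Φ} : ℝ) =
      sfun (Nat.card (IsLocalRing.ResidueField R)) m (rkR R (M ⧸ C)) := by
  rw [← card_surj R (M ⧸ C) m]
  congr 1
  refine Nat.card_congr
    { toFun := fun Φ => ⟨C.liftQ Φ.1 Φ.2.2, fun y => by
        obtain ⟨x, hx⟩ := Φ.2.1 y
        exact ⟨Submodule.Quotient.mk x, hx⟩⟩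
      invFun := fun Φ => ⟨Φ.1.comp C.mkQ, Φ.2.comp (Submodule.mkQ_surjective C), fun x hx => by
        rw [LinearMap.mem_ker, LinearMap.comp_apply, Submodule.mkQ_apply,
          (Submodule.Quotient.mk_eq_zero C).2 hx, map_zero]⟩
      left_inv := fun Φ => by ext; rfl
      right_inv := fun Φ => by
        apply Subtype.ext
        apply Submodule.linearMap_qext
        ext; rfl }

lemma card_quot {R E V : Type} [CommRing R] [AddCommGroup E] [Module R E] [AddCommGroup V] [Module R V]
    (K : Submodule R E) (Φ : K →ₗ[R] V) :
    Nat.card (E ⧸ (LinearMap.ker Φ).map K.subtype) = Nat.card (Set.range Φ) * Nat.card (E ⧸ K) := by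
  have hle : ((LinearMap.ker Φ).map K.subtype).toAddSubgroup ≤ K.toAddSubgroup :=
    Submodule.map_subtype_le _ _
  have h := AddSubgroup.relIndex_mul_index hle
  have h1 : ((LinearMap.ker Φ).map K.subtype).toAddSubgroup.relIndex K.toAddSubgroup =
      Nat.card (Set.range Φ) := by
    have : ((LinearMap.ker Φ).map K.subtype).toAddSubgroup.addSubgroupOf K.toAddSubgroup =
        AddMonoidHom.ker Φ.toAddMonoidHom := by
      ext x
      rw [AddSubgroup.mem_addSubgroupOf, AddMonoidHom.mem_ker]
      constructor
      · rintro ⟨y, hy, hyx⟩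
        have : y = x := Subtype.ext hyx
        rw [← this]; exact hy
      · intro hx
        exact ⟨x, hx, rfl⟩
    rw [AddSubgroup.relIndex, this, AddSubgroup.index_ker]
    rfl
  rw [h1] at h
  exact h.symm

lemma colR_map {S : Type} [CommRing S] {n : ℕ} (P : S[X]) (X : Fin n → Fin n → S) {H : Type}
    [AddCommGroup H] [Module (AdjoinRoot P) H] (f : (Fin n → AdjoinRoot P) →ₗ[AdjoinRoot P] H) (i : Fin n) :
    f (colR P X i) = ∑ k, algebraMap S (AdjoinRoot P) (X k i) • f (Pi.single k 1) -
      AdjoinRoot.root P • f (Pi.single i 1) := by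
  have : colR P X i = ∑ k, algebraMap S (AdjoinRoot P) (X k i) • (Pi.single k 1 : Fin n → AdjoinRoot P) -
      AdjoinRoot.root P • (Pi.single i 1 : Fin n → AdjoinRoot P) := by
    rw [← pi_eq_sum_single (fun k => algebraMap S (AdjoinRoot P) (X k i))]
    funext k
    by_cases h : k = i
    · subst h; simp [colR]
    · simp [colR, h]
  rw [this, map_sub, map_sum, map_smul]
  simp only [map_smul]

lemma count_int {Ω α : Type} [MeasurableSpace Ω] (μ : Measure Ω) [IsFiniteMeasure μ] [Fintype α]
    (S : α → Set Ω) (hS : ∀ a, MeasurableSet (S a)) :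
    Measurable (fun X => (Nat.card {a // X ∈ S a} : ℝ)) ∧
    Integrable (fun X => (Nat.card {a // X ∈ S a} : ℝ)) μ ∧
    ∫ X, (Nat.card {a // X ∈ S a} : ℝ) ∂μ = ∑ a, μ.real (S a) := by
  classical
  have h : (fun X => (Nat.card {a // X ∈ S a} : ℝ)) = fun X => ∑ a, (S a).indicator (fun _ => (1 : ℝ)) X := by
    funext X
    rw [Nat.card_eq_fintype_card, Fintype.card_subtype, Finset.card_filter]
    push_cast
    refine Finset.sum_congr rfl fun a _ => ?_
    simp [Set.indicator_apply]
  have hi : ∀ a, Integrable ((S a).indicator (fun _ => (1 : ℝ))) μ := fun a =>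
    (integrable_const 1).indicator (hS a)
  rw [h]
  refine ⟨Finset.measurable_sum _ fun a _ => measurable_const.indicator (hS a),
    integrable_finsetSum _ fun a _ => hi a, ?_⟩
  rw [integral_finsetSum _ fun a _ => hi a]
  refine Finset.sum_congr rfl fun a _ => ?_
  rw [integral_indicator (hS a), setIntegral_const, smul_eq_mul, mul_one]

end PartA9

section PartB1
open Filter Topology MeasureTheory Polynomial

section Fam
variable {p : ℕ} [Fact p.Prime] {ι : Type} [Fintype ι] [DecidableEq ι] {P : ι → ℤ_[p][X]} {n : ℕ}

lemma mem_Ev_iff {H : ι → Type} [∀ j, AddCommGroup (H j)] [∀ j, Module (AdjoinRoot (P j)) (H j)]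
    (f : ∀ j, (Fin n → AdjoinRoot (P j)) →ₗ[AdjoinRoot (P j)] H j) (X : Fin n → Fin n → ℤ_[p]) :
    X ∈ Ev P (fun j k => f j (Pi.single k 1)) ↔ ∀ j, colSpan (P j) X ≤ LinearMap.ker (f j) := by
  refine forall_congr' fun j => ?_
  rw [colSpan, Submodule.span_le, Set.range_subset_iff]
  refine forall_congr' fun i => ?_
  rw [SetLike.mem_coe, LinearMap.mem_ker, colR_map, sub_eq_zero]

variable {G : ι → Type} [∀ j, AddCommGroup (G j)] [∀ j, Module (AdjoinRoot (P j)) (G j)]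

/-- kernel of the presentation -/
noncomputable abbrev KK (P : ι → ℤ_[p][X]) [∀ j, Module (AdjoinRoot (P j)) (G j)] (g : ∀ j, Fin n → G j) (j : ι) :
    Submodule (AdjoinRoot (P j)) (Fin n → AdjoinRoot (P j)) :=
  LinearMap.ker (Fintype.linearCombination (AdjoinRoot (P j)) (g j))

/-- second kernel -/
noncomputable abbrev K2 {V : ι → Type} [∀ j, AddCommGroup (V j)] [∀ j, Module (AdjoinRoot (P j)) (V j)]
    {g : ∀ j, Fin n → G j} (Φ : ∀ j, KK P g j →ₗ[AdjoinRoot (P j)] V j) (j : ι) :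
    Submodule (AdjoinRoot (P j)) (Fin n → AdjoinRoot (P j)) :=
  (LinearMap.ker (Φ j)).map (KK P g j).subtype

/-- second generators -/
noncomputable def h2 {V : ι → Type} [∀ j, AddCommGroup (V j)] [∀ j, Module (AdjoinRoot (P j)) (V j)]
    {g : ∀ j, Fin n → G j} (Φ : ∀ j, KK P g j →ₗ[AdjoinRoot (P j)] V j) (j : ι) (k : Fin n) :
    (Fin n → AdjoinRoot (P j)) ⧸ K2 Φ j :=
  (K2 Φ j).mkQ (Pi.single k 1)

lemma mem_Ev_g (g : ∀ j, Fin n → G j) (X : Fin n → Fin n → ℤ_[p]) :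
    X ∈ Ev P g ↔ ∀ j, colSpan (P j) X ≤ KK P g j := by
  rw [← mem_Ev_iff]
  simp only [Fintype.linearCombination_apply_single, one_smul]

variable {V : ι → Type} [∀ j, AddCommGroup (V j)] [∀ j, Module (AdjoinRoot (P j)) (V j)]

lemma mem_Ev_h2 {g : ∀ j, Fin n → G j} (Φ : ∀ j, KK P g j →ₗ[AdjoinRoot (P j)] V j)
    (X : Fin n → Fin n → ℤ_[p]) :
    X ∈ Ev P (h2 Φ) ↔ X ∈ Ev P g ∧
      ∀ j, (colSpan (P j) X).comap (KK P g j).subtype ≤ LinearMap.ker (Φ j) := by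
  have h1 : X ∈ Ev P (h2 Φ) ↔ ∀ j, colSpan (P j) X ≤ K2 Φ j := by
    have := mem_Ev_iff (fun j => (K2 Φ j).mkQ) X
    simpa only [Submodule.ker_mkQ] using! this
  rw [h1, mem_Ev_g, ← forall_and]
  refine forall_congr' fun j => ?_
  constructor
  · intro h
    refine ⟨h.trans (Submodule.map_subtype_le _ _), fun x hx => ?_⟩
    obtain ⟨y, hy, hyx⟩ := h hx
    have : y = x := Subtype.ext hyx
    rw [← this]; exact hy
  · rintro ⟨ha, hb⟩ x hx
    exact ⟨⟨x, ha hx⟩, hb (x := ⟨x, ha hx⟩) hx, rfl⟩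

lemma h2_card {g : ∀ j, Fin n → G j} (Φ : ∀ j, KK P g j →ₗ[AdjoinRoot (P j)] V j) (j : ι)
    (hs : Function.Surjective (Fintype.linearCombination (AdjoinRoot (P j)) (g j))) :
    Nat.card ((Fin n → AdjoinRoot (P j)) ⧸ K2 Φ j) = Nat.card (Set.range (Φ j)) * Nat.card (G j) := by
  rw [card_quot]
  congr 1
  exact Nat.card_congr (LinearMap.quotKerEquivOfSurjective _ hs).toEquiv

lemma h2_span {g : ∀ j, Fin n → G j} (Φ : ∀ j, KK P g j →ₗ[AdjoinRoot (P j)] V j) (j : ι) :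
    Submodule.span (AdjoinRoot (P j)) (Set.range (h2 Φ j)) = ⊤ := by
  rw [eq_top_iff]
  intro y _
  obtain ⟨y, rfl⟩ := Submodule.Quotient.mk_surjective _ y
  rw [pi_eq_sum_single y, ← Submodule.mkQ_apply, map_sum]
  refine Submodule.sum_mem _ fun i _ => ?_
  rw [map_smul]
  exact Submodule.smul_mem _ _ (Submodule.subset_span ⟨i, rfl⟩)

lemma lc_surj_of_gen (g : ∀ j, Fin n → G j) (hg : Gen g) (j : ι) :
    Function.Surjective (Fintype.linearCombination (AdjoinRoot (P j)) (g j)) := by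
  have h1 : AddSubgroup.closure (Set.range fun k j => g j k) ≤
      (LinearMap.range (Fintype.linearCombination (AdjoinRoot (P j)) (g j))).toAddSubgroup.comap
        (Pi.evalAddMonoidHom G j) := by
    rw [AddSubgroup.closure_le]
    rintro _ ⟨k, rfl⟩
    exact ⟨Pi.single k 1, by simp [Fintype.linearCombination_apply_single]⟩
  intro y
  have h2 : Pi.single j y ∈ AddSubgroup.closure (Set.range fun k j => g j k) := by
    rw [show AddSubgroup.closure (Set.range fun k j => g j k) = ⊤ from hg]; trivial
  obtain ⟨x, hx⟩ := h1 h2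
  exact ⟨x, by simpa using hx⟩

/-- sample vectors in the kernels -/
noncomputable def ff (g : ∀ j, Fin n → G j) (s : Fin n → Fin n) (hs : ∀ i j, g j (s i) = g j i)
    (i : Fin n) (j : ι) : KK P g j :=
  ⟨Pi.single i 1 - Pi.single (s i) 1, by
    rw [LinearMap.mem_ker, map_sub, Fintype.linearCombination_apply_single,
      Fintype.linearCombination_apply_single, hs, sub_self]⟩

lemma good_of_gen (g : ∀ j, Fin n → G j) (hg : Gen g) (s : Fin n → Fin n)
    (hs : ∀ i j, g j (s i) = g j i) {I : Type} (t : I → Fin n)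
    (Φ : ∀ j, KK P g j →ₗ[AdjoinRoot (P j)] V j)
    (hΦ : AddSubgroup.closure (Set.range fun (i : I) j => Φ j (ff g s hs (t i) j)) = ⊤) :
    (∀ j, Function.Surjective (Φ j)) ∧ Gen (h2 Φ) := by
  constructor
  · intro j
    have h1 : AddSubgroup.closure (Set.range fun (i : I) j => Φ j (ff g s hs (t i) j)) ≤
        (LinearMap.range (Φ j)).toAddSubgroup.comap (Pi.evalAddMonoidHom V j) := by
      rw [AddSubgroup.closure_le]
      rintro _ ⟨k, rfl⟩
      exact ⟨_, rfl⟩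
    intro y
    have h2 : Pi.single j y ∈ AddSubgroup.closure (Set.range fun (i : I) j => Φ j (ff g s hs (t i) j)) := by
      rw [hΦ]; trivial
    obtain ⟨x, hx⟩ := h1 h2
    exact ⟨x, by simpa using hx⟩
  · rw [Gen]
    set N := AddSubgroup.closure (Set.range fun k j => h2 Φ j k) with hN
    have hgen : ∀ k, (fun j => h2 Φ j k) ∈ N := fun k => AddSubgroup.subset_closure ⟨k, rfl⟩
    have c1 : ∀ z ∈ AddSubgroup.closure (Set.range fun k j => g j k),
        ∃ x : ∀ j, Fin n → AdjoinRoot (P j), (fun j => (K2 Φ j).mkQ (x j)) ∈ N ∧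
          ∀ j, Fintype.linearCombination (AdjoinRoot (P j)) (g j) (x j) = z j := by
      intro z hz
      induction hz using AddSubgroup.closure_induction with
      | mem x hx =>
        obtain ⟨k, rfl⟩ := hx
        exact ⟨fun j => Pi.single k 1, hgen k, fun j => by simp [Fintype.linearCombination_apply_single]⟩
      | zero => exact ⟨fun j => 0, by simp only [map_zero]; exact N.zero_mem, fun j => by simp⟩
      | add a b _ _ ha hb =>
        obtain ⟨x, hx, hx'⟩ := ha
        obtain ⟨y, hy, hy'⟩ := hb
        exact ⟨fun j => x j + y j, by simp only [map_add]; exact N.add_mem hx hy, fun j => by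
          rw [map_add, hx', hy', Pi.add_apply]⟩
      | neg a _ ha =>
        obtain ⟨x, hx, hx'⟩ := ha
        exact ⟨fun j => - x j, by simp only [map_neg]; exact N.neg_mem hx, fun j => by
          rw [map_neg, hx', Pi.neg_apply]⟩
    have c2 : ∀ z ∈ AddSubgroup.closure (Set.range fun (i : I) j => Φ j (ff g s hs (t i) j)),
        ∃ x : ∀ j, KK P g j, (fun j => (K2 Φ j).mkQ (x j : Fin n → AdjoinRoot (P j))) ∈ N ∧
          ∀ j, Φ j (x j) = z j := by
      intro z hz
      induction hz using AddSubgroup.closure_induction with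
      | mem x hx =>
        obtain ⟨i, rfl⟩ := hx
        refine ⟨fun j => ff g s hs (t i) j, ?_, fun j => rfl⟩
        have := N.sub_mem (hgen (t i)) (hgen (s (t i)))
        convert this using 1
        funext j
        simp only [ff, map_sub]; rfl
      | zero => exact ⟨fun j => 0, by
          simp only [ZeroMemClass.coe_zero, map_zero]; exact N.zero_mem, fun j => by simp⟩
      | add a b _ _ ha hb =>
        obtain ⟨x, hx, hx'⟩ := ha
        obtain ⟨y, hy, hy'⟩ := hb
        exact ⟨fun j => x j + y j, by
          simp only [Submodule.coe_add, map_add]; exact N.add_mem hx hy, fun j => by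
          rw [map_add, hx', hy', Pi.add_apply]⟩
      | neg a _ ha =>
        obtain ⟨x, hx, hx'⟩ := ha
        exact ⟨fun j => - x j, by
          simp only [NegMemClass.coe_neg, map_neg]; exact N.neg_mem hx, fun j => by
          rw [map_neg, hx', Pi.neg_apply]⟩
    rw [eq_top_iff]
    intro y _
    choose x hx using fun j => Submodule.Quotient.mk_surjective _ (y j)
    obtain ⟨a, ha, ha'⟩ := c1 (fun j => Fintype.linearCombination (AdjoinRoot (P j)) (g j) (x j)) (by
      rw [show AddSubgroup.closure (Set.range fun k j => g j k) = ⊤ from hg]; trivial)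
    let d : ∀ j, KK P g j := fun j => ⟨x j - a j, by rw [LinearMap.mem_ker, map_sub, ha', sub_self]⟩
    obtain ⟨b, hb, hb'⟩ := c2 (fun j => Φ j (d j)) (by rw [hΦ]; trivial)
    have h3 : y = (fun j => (K2 Φ j).mkQ (a j)) + fun j => (K2 Φ j).mkQ (b j : Fin n → AdjoinRoot (P j)) := by
      funext j
      rw [← hx, Pi.add_apply, ← map_add, ← Submodule.mkQ_apply, ← sub_eq_zero, ← map_sub,
        Submodule.mkQ_apply, Submodule.Quotient.mk_eq_zero]
      refine ⟨d j - b j, ?_, ?_⟩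
      · rw [SetLike.mem_coe, LinearMap.mem_ker, map_sub, hb', sub_self]
      · simp only [Submodule.subtype_apply, Submodule.coe_sub, d]; abel
    rw [h3]
    exact N.add_mem ha hb

/-- sampling homomorphism -/
noncomputable def TT (g : ∀ j, Fin n → G j) (s : Fin n → Fin n)
    (hs : ∀ i j, g j (s i) = g j i) {I : Type} (t : I → Fin n) :
    (∀ j, KK P g j →ₗ[AdjoinRoot (P j)] V j) →+ (I → ∀ j, V j) where
  toFun Φ := fun i j => Φ j (ff g s hs (t i) j)
  map_zero' := rfl
  map_add' _ _ := rfl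

lemma TT_surj (g : ∀ j, Fin n → G j) (s : Fin n → Fin n) (hs : ∀ i j, g j (s i) = g j i) :
    Function.Surjective (TT (P := P) (V := V) g s hs (I := {i // i ∉ Set.range s}) Subtype.val) := by
  classical
  intro v
  refine ⟨fun j => (Fintype.linearCombination (AdjoinRoot (P j))
    (fun i => if h : i ∉ Set.range s then v ⟨i, h⟩ j else 0)).comp (KK P g j).subtype, ?_⟩
  funext i j
  change Fintype.linearCombination (AdjoinRoot (P j))
    (fun i => if h : i ∉ Set.range s then v ⟨i, h⟩ j else 0)
      (Pi.single i.1 1 - Pi.single (s i.1) 1) = v i j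
  rw [map_sub, Fintype.linearCombination_apply_single, Fintype.linearCombination_apply_single,
    dif_pos i.2, dif_neg (by simp)]
  simp

lemma exists_section [∀ j, Finite (G j)] (g : ∀ j, Fin n → G j) : ∃ s : Fin n → Fin n,
    (∀ i j, g j (s i) = g j i) ∧ n - (∏ j, Nat.card (G j)) ≤ Fintype.card {i // i ∉ Set.range s} := by
  classical
  let c : (Set.range fun (k : Fin n) j => g j k) → Fin n := fun y => y.2.choose
  have hc : ∀ y, (fun j => g j (c y)) = y.1 := fun y => y.2.choose_spec
  let s : Fin n → Fin n := fun i => c ⟨fun j => g j i, i, rfl⟩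
  refine ⟨s, fun i j => congrFun (hc ⟨fun j => g j i, i, rfl⟩) j, ?_⟩
  have h1 : Fintype.card {i // i ∉ Set.range s} = n - Fintype.card {i // i ∈ Set.range s} := by
    rw [Fintype.card_subtype_compl, Fintype.card_fin]
  rw [h1]
  have h2 : Fintype.card {i // i ∈ Set.range s} ≤ ∏ j, Nat.card (G j) := by
    rw [← Nat.card_pi, ← Nat.card_eq_fintype_card]
    refine Nat.card_le_card_of_injective (fun i => fun j => g j i.1) ?_
    rintro ⟨_, i, rfl⟩ ⟨_, i', rfl⟩ h
    have e : ∀ i, (fun j => g j (s i)) = fun j => g j i := fun i => hc ⟨fun j => g j i, i, rfl⟩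
    have h' : (fun j => g j (s i)) = fun j => g j (s i') := h
    rw [e, e] at h'
    apply Subtype.ext
    simp only [s, h']
  omega

end Fam

end PartB1

section PartB2
open Filter Topology MeasureTheory Polynomial

section Mom2
variable {p : ℕ} [Fact p.Prime] {ι : Type} [Fintype ι] [DecidableEq ι] {P : ι → ℤ_[p][X]} {n : ℕ}
  [∀ j, IsDomain (AdjoinRoot (P j))] [∀ j, IsPrincipalIdealRing (AdjoinRoot (P j))]
  [∀ j, CharZero (AdjoinRoot (P j))]
  {G : ι → Type} [∀ j, AddCommGroup (G j)] [∀ j, Module (AdjoinRoot (P j)) (G j)] [∀ j, Finite (G j)]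
  {V : ι → Type} [∀ j, AddCommGroup (V j)] [∀ j, Module (AdjoinRoot (P j)) (V j)] [∀ j, Finite (V j)]

lemma KK_quot_fin (g : ∀ j, Fin n → G j) (j : ι) : Finite ((Fin n → AdjoinRoot (P j)) ⧸ KK P g j) :=
  Finite.of_equiv _ (LinearMap.quotKerEquivRange (Fintype.linearCombination (AdjoinRoot (P j)) (g j))).toEquiv.symm

lemma homT_card (g : ∀ j, Fin n → G j) :
    Nat.card (∀ j, KK P g j →ₗ[AdjoinRoot (P j)] V j) = (∏ j, Nat.card (V j)) ^ n := by
  rw [Nat.card_pi, ← Finset.prod_pow]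
  refine Finset.prod_congr rfl fun j _ => ?_
  haveI := KK_quot_fin (P := P) g j
  exact card_hom (KK P g j) (V j)

lemma homT_fin (g : ∀ j, Fin n → G j) : Finite (∀ j, KK P g j →ₗ[AdjoinRoot (P j)] V j) :=
  Nat.finite_of_card_ne_zero (by
    rw [homT_card]; exact pow_ne_zero _ (Finset.prod_ne_zero_iff.2 fun j _ => Nat.card_pos.ne'))

lemma h2_fin {g : ∀ j, Fin n → G j} (hg : Gen g) (Φ : ∀ j, KK P g j →ₗ[AdjoinRoot (P j)] V j) (j : ι) :
    Finite ((Fin n → AdjoinRoot (P j)) ⧸ K2 Φ j) := by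
  refine Nat.finite_of_card_ne_zero ?_
  rw [h2_card Φ j (lc_surj_of_gen g hg j)]
  exact mul_ne_zero Nat.card_pos.ne' Nat.card_pos.ne'

/-- the count -/
noncomputable def Ycount (P : ι → ℤ_[p][X]) {G : ι → Type} [∀ j, AddCommGroup (G j)]
    [∀ j, Module (AdjoinRoot (P j)) (G j)] (V : ι → Type) [∀ j, AddCommGroup (V j)]
    [∀ j, Module (AdjoinRoot (P j)) (V j)] (g : ∀ j, Fin n → G j) (X : Fin n → Fin n → ℤ_[p]) : ℝ :=
  Nat.card {Φ : {Φ : ∀ j, KK P g j →ₗ[AdjoinRoot (P j)] V j // ∀ j, Function.Surjective (Φ j)} //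
    X ∈ Ev P (h2 Φ.1)}

variable (hP : Pairwise (Function.onFun IsCoprime P))
  (μ : Measure (Fin n → Fin n → ℤ_[p])) [IsProbabilityMeasure μ] [μ.IsAddHaarMeasure]
  (g : ∀ j, Fin n → G j) (hg : Gen g)

include hg in
lemma Y_int : Measurable (Ycount P V g) ∧ Integrable (Ycount P V g) μ := by
  haveI := homT_fin (P := P) (V := V) g
  haveI : Fintype {Φ : ∀ j, KK P g j →ₗ[AdjoinRoot (P j)] V j // ∀ j, Function.Surjective (Φ j)} :=
    Fintype.ofFinite _
  have h := count_int μ (fun Φ : {Φ : ∀ j, KK P g j →ₗ[AdjoinRoot (P j)] V j //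
      ∀ j, Function.Surjective (Φ j)} => Ev P (h2 Φ.1)) (fun Φ => by
        haveI := h2_fin hg Φ.1
        exact Ev_meas _)
  exact ⟨h.1, h.2.1⟩

include hg hP in
lemma Y_mom : ∫ X, Ycount P V g X ∂μ = (((∏ j, Nat.card (G j) : ℕ) : ℝ) ^ n)⁻¹ *
    ((((∏ j, Nat.card (V j) : ℕ) : ℝ) ^ n)⁻¹ *
      Nat.card {Φ : {Φ : ∀ j, KK P g j →ₗ[AdjoinRoot (P j)] V j // ∀ j, Function.Surjective (Φ j)} //
        Gen (h2 Φ.1)}) := by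
  classical
  haveI := homT_fin (P := P) (V := V) g
  haveI : Fintype {Φ : ∀ j, KK P g j →ₗ[AdjoinRoot (P j)] V j // ∀ j, Function.Surjective (Φ j)} :=
    Fintype.ofFinite _
  have h := count_int μ (fun Φ : {Φ : ∀ j, KK P g j →ₗ[AdjoinRoot (P j)] V j //
      ∀ j, Function.Surjective (Φ j)} => Ev P (h2 Φ.1)) (fun Φ => by
        haveI := h2_fin hg Φ.1
        exact Ev_meas _)
  have h' := h.2.2
  have e : ∀ Φ : {Φ : ∀ j, KK P g j →ₗ[AdjoinRoot (P j)] V j // ∀ j, Function.Surjective (Φ j)},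
      μ.real (Ev P (h2 Φ.1)) = if Gen (h2 Φ.1) then (((∏ j, Nat.card (G j) : ℕ) : ℝ) ^ n)⁻¹ *
    (((∏ j, Nat.card (V j) : ℕ) : ℝ) ^ n)⁻¹ else 0 := by
    intro Φ
    haveI := h2_fin hg Φ.1
    split_ifs with hG
    · have hpr : ∏ j, Nat.card ((Fin n → AdjoinRoot (P j)) ⧸ K2 Φ.1 j) =
          ∏ j, (Nat.card (G j) * Nat.card (V j)) := Finset.prod_congr rfl fun j _ => ?_
      · rw [Ev_real μ _ hG, ← mul_inv, ← mul_pow, ← Nat.cast_mul, ← Finset.prod_mul_distrib, hpr]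
      rw [h2_card Φ.1 j (lc_surj_of_gen g hg j), (Φ.2 j).range_eq, mul_comm,
        Nat.card_congr (Equiv.Set.univ (V j))]
    · have : Ev P (h2 Φ.1) = ∅ := by
        rw [Set.eq_empty_iff_forall_notMem]
        intro X hX
        exact hG (Ev_gen hP _ (h2_span Φ.1) hX)
      rw [this, measureReal_empty]
  change ∫ X, (Nat.card {Φ : {Φ : ∀ j, KK P g j →ₗ[AdjoinRoot (P j)] V j // ∀ j, Function.Surjective (Φ j)} //
    X ∈ Ev P (h2 Φ.1)} : ℝ) ∂μ = _
  rw [h', Finset.sum_congr rfl fun Φ _ => e Φ, ← Finset.sum_filter, Finset.sum_const, nsmul_eq_mul,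
    Nat.card_eq_fintype_card (α := {Φ : {Φ : ∀ j, KK P g j →ₗ[AdjoinRoot (P j)] V j //
      ∀ j, Function.Surjective (Φ j)} // Gen (h2 Φ.1)}), Fintype.card_subtype]
  ring

include hg hP in
lemma Y_upper : ∫ X, Ycount P V g X ∂μ ≤ (((∏ j, Nat.card (G j) : ℕ) : ℝ) ^ n)⁻¹ := by
  haveI := homT_fin (P := P) (V := V) g
  rw [Y_mom hP μ g hg]
  refine mul_le_of_le_one_right (by positivity) ?_
  have h0 : (0 : ℝ) < ((∏ j, Nat.card (V j) : ℕ) : ℝ) ^ n :=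
    pow_pos (Nat.cast_pos.2 (Finset.prod_pos fun j _ => Nat.card_pos)) _
  rw [inv_mul_le_iff₀ h0, mul_one, ← Nat.cast_pow, ← homT_card (P := P) g, Nat.cast_le]
  exact (Finite.card_subtype_le _).trans (Finite.card_subtype_le _)

include hg hP in
lemma Y_lower : (((∏ j, Nat.card (G j) : ℕ) : ℝ) ^ n)⁻¹ *
      (1 - Nat.card (AddSubgroup (∀ j, V j)) / 2 ^ (n - ∏ j, Nat.card (G j))) ≤
    ∫ X, Ycount P V g X ∂μ := by
  haveI := homT_fin (P := P) (V := V) g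
  rw [Y_mom hP μ g hg]
  refine mul_le_mul_of_nonneg_left ?_ (by positivity)
  have h0 : (0 : ℝ) < ((∏ j, Nat.card (V j) : ℕ) : ℝ) ^ n :=
    pow_pos (Nat.cast_pos.2 (Finset.prod_pos fun j _ => Nat.card_pos)) _
  rw [le_inv_mul_iff₀ h0, ← Nat.cast_pow, ← homT_card (P := P) g]
  obtain ⟨s, hs, hn⟩ := exists_section g
  classical
  have hb := bad_count (TT (P := P) (V := V) g s hs (I := {i // i ∉ Set.range s}) Subtype.val)
    (TT_surj g s hs)
  set A := ∀ j, KK P g j →ₗ[AdjoinRoot (P j)] V j with hA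
  let T := TT (P := P) (V := V) g s hs (I := {i // i ∉ Set.range s}) Subtype.val
  have h1 : Nat.card A ≤ Nat.card {Φ : {Φ : A // ∀ j, Function.Surjective (Φ j)} // Gen (h2 Φ.1)} +
      Nat.card {a : A // AddSubgroup.closure (Set.range (T a)) ≠ ⊤} := by
    rw [← Nat.card_sum]
    refine Nat.card_le_card_of_surjective (fun x => Sum.elim (fun Φ => Φ.1.1) (fun a => a.1) x) ?_
    intro a
    by_cases ha : AddSubgroup.closure (Set.range (T a)) = ⊤
    · have := good_of_gen g hg s hs Subtype.val a ha
      exact ⟨Sum.inl ⟨⟨a, this.1⟩, this.2⟩, rfl⟩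
    · exact ⟨Sum.inr ⟨a, ha⟩, rfl⟩
  have h1' : (Nat.card A : ℝ) ≤ Nat.card {Φ : {Φ : A // ∀ j, Function.Surjective (Φ j)} // Gen (h2 Φ.1)} +
      Nat.card {a : A // AddSubgroup.closure (Set.range (T a)) ≠ ⊤} := by exact_mod_cast h1
  have hb' : (Nat.card {a : A // AddSubgroup.closure (Set.range (T a)) ≠ ⊤} : ℝ) *
      2 ^ (n - ∏ j, Nat.card (G j)) ≤ Nat.card (AddSubgroup (∀ j, V j)) * Nat.card A := by
    have : Nat.card {a : A // AddSubgroup.closure (Set.range (T a)) ≠ ⊤} *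
      2 ^ (n - ∏ j, Nat.card (G j)) ≤ Nat.card (AddSubgroup (∀ j, V j)) * Nat.card A := by
      refine le_trans (Nat.mul_le_mul_left _ (Nat.pow_le_pow_right (by norm_num) ?_)) hb
      convert hn
    exact_mod_cast this
  rw [← le_div_iff₀ (by positivity)] at hb'
  calc _ = (Nat.card A : ℝ) - Nat.card (AddSubgroup (∀ j, V j)) * Nat.card A / 2 ^ (n - ∏ j, Nat.card (G j)) := by ring
    _ ≤ _ := by linarith

end Mom2

end PartB2

section PartB3
open Filter Topology MeasureTheory Polynomial

section App
variable {p : ℕ} [Fact p.Prime] {ι : Type} [Fintype ι] [DecidableEq ι] {P : ι → ℤ_[p][X]}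
  [∀ j, IsDomain (AdjoinRoot (P j))] [∀ j, IsDiscreteValuationRing (AdjoinRoot (P j))]
  [∀ j, CharZero (AdjoinRoot (P j))] [∀ j, Finite (IsLocalRing.ResidueField (AdjoinRoot (P j)))]
  {G : ι → Type} [∀ j, AddCommGroup (G j)] [∀ j, Module (AdjoinRoot (P j)) (G j)] [∀ j, Finite (G j)]

/-- target spaces -/
abbrev VV (P : ι → ℤ_[p][X]) [∀ j, IsDomain (AdjoinRoot (P j))] [∀ j, IsDiscreteValuationRing (AdjoinRoot (P j))]
    (m : ι → ℕ) (j : ι) : Type :=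
  Fin (m j) → IsLocalRing.ResidueField (AdjoinRoot (P j))

/-- rank vector -/
noncomputable def rr {n : ℕ} (P : ι → ℤ_[p][X]) [∀ j, IsDomain (AdjoinRoot (P j))]
    [∀ j, IsDiscreteValuationRing (AdjoinRoot (P j))] [∀ j, Module (AdjoinRoot (P j)) (G j)]
    (g : ∀ j, Fin n → G j) (X : Fin n → Fin n → ℤ_[p]) (j : ι) : ℕ :=
  rkR (AdjoinRoot (P j)) (KK P g j ⧸ (colSpan (P j) X).comap (KK P g j).subtype)

lemma Y_eq {n : ℕ} (g : ∀ j, Fin n → G j) (m : ι → ℕ) (X : Fin n → Fin n → ℤ_[p]) (hX : X ∈ Ev P g) :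
    Ycount P (VV P m) g X = ∏ j, sfun (Nat.card (IsLocalRing.ResidueField (AdjoinRoot (P j)))) (m j)
      (rr P g X j) := by
  rw [Ycount]
  simp only [rr]
  have : ∀ j, (sfun (Nat.card (IsLocalRing.ResidueField (AdjoinRoot (P j)))) (m j)
      (rkR (AdjoinRoot (P j)) (KK P g j ⧸ (colSpan (P j) X).comap (KK P g j).subtype))) =
      (Nat.card {Φ : KK P g j →ₗ[AdjoinRoot (P j)] VV P m j //
      Function.Surjective Φ ∧ (colSpan (P j) X).comap (KK P g j).subtype ≤ LinearMap.ker Φ} : ℝ) :=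
    fun j => (card_kill _ _ _ _).symm
  rw [Finset.prod_congr rfl fun j _ => this j, ← Nat.cast_prod, ← Nat.card_pi]
  congr 1
  refine Nat.card_congr
    { toFun := fun Φ j => ⟨Φ.1.1 j, Φ.1.2 j, ((mem_Ev_h2 _ _).1 Φ.2).2 j⟩
      invFun := fun Φ => ⟨⟨fun j => (Φ j).1, fun j => (Φ j).2.1⟩,
        (mem_Ev_h2 _ _).2 ⟨hX, fun j => (Φ j).2.2⟩⟩
      left_inv := fun Φ => rfl
      right_inv := fun Φ => rfl }

lemma Y_eq_zero {n : ℕ} (g : ∀ j, Fin n → G j) (m : ι → ℕ) (X : Fin n → Fin n → ℤ_[p]) (hX : X ∉ Ev P g) :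
    Ycount P (VV P m) g X = 0 := by
  rw [Ycount]
  haveI : IsEmpty {Φ : {Φ : ∀ j, KK P g j →ₗ[AdjoinRoot (P j)] VV P m j // ∀ j, Function.Surjective (Φ j)} //
    X ∈ Ev P (h2 Φ.1)} := ⟨fun Φ => hX ((mem_Ev_h2 _ _).1 Φ.2).1⟩
  simp

/-- exact event -/
def BB {n : ℕ} (P : ι → ℤ_[p][X]) [∀ j, Module (AdjoinRoot (P j)) (G j)]
    (g : ∀ j, Fin n → G j) : Set (Fin n → Fin n → ℤ_[p]) :=
  {X | ∀ j, colSpan (P j) X = KK P g j}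

lemma mem_BB {n : ℕ} (g : ∀ j, Fin n → G j) (X : Fin n → Fin n → ℤ_[p]) :
    X ∈ BB P g ↔ X ∈ Ev P g ∧ ∀ j, rr P g X j = 0 := by
  rw [mem_Ev_g, ← forall_and]
  refine forall_congr' fun j => ?_
  rw [rr, rkR_eq_zero, Submodule.Quotient.subsingleton_iff, Submodule.comap_subtype_eq_top]
  exact le_antisymm_iff

lemma BB_meas {n : ℕ} (μ : Measure (Fin n → Fin n → ℤ_[p])) [IsProbabilityMeasure μ] [μ.IsAddHaarMeasure]
    (hq : ∀ j, 2 ≤ (Nat.card (IsLocalRing.ResidueField (AdjoinRoot (P j))) : ℝ))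
    (g : ∀ j, Fin n → G j) (hg : Gen g) : MeasurableSet (BB P g) := by
  have h : BB P g = Ev P g ∩ ⋂ j, (Ycount P (VV P (Pi.single j 1)) g) ⁻¹' {0} := by
    ext X
    rw [mem_BB, Set.mem_inter_iff, Set.mem_iInter]
    refine and_congr_right fun hX => forall_congr' fun j => ?_
    rw [Set.mem_preimage, Set.mem_singleton_iff, Y_eq g _ X hX, Finset.prod_eq_single j]
    · have h1 := hq j
      simp only [Pi.single_eq_same, sfun, Finset.prod_range_one, pow_zero, sub_eq_zero]
      constructor
      · intro h; rw [h, pow_zero]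
      · intro h
        by_contra hne
        have := one_lt_pow₀ (by linarith : 1 < (Nat.card (IsLocalRing.ResidueField (AdjoinRoot (P j))) : ℝ)) hne
        linarith
    · intro b _ hb
      simp [Pi.single_eq_of_ne hb, sfun]
    · simp
  rw [h]
  exact (Ev_meas g).inter (MeasurableSet.iInter fun j =>
    (Y_int (V := VV P (Pi.single j 1)) μ g hg).1 (measurableSet_singleton 0))

lemma gen_limit (hP : Pairwise (Function.onFun IsCoprime P))
    (hq : ∀ j, 2 ≤ (Nat.card (IsLocalRing.ResidueField (AdjoinRoot (P j))) : ℝ)) (ε : ℝ) (hε : 0 < ε) :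
    ∃ n0 : ℕ, ∀ n ≥ n0, ∀ (μ : Measure (Fin n → Fin n → ℤ_[p])) [IsProbabilityMeasure μ] [μ.IsAddHaarMeasure]
      (g : ∀ j, Fin n → G j), Gen g →
      |μ.real (BB P g) - (((∏ j, Nat.card (G j) : ℕ) : ℝ) ^ n)⁻¹ *
        ∏ j, ∏' i : ℕ, (1 - ((Nat.card (IsLocalRing.ResidueField (AdjoinRoot (P j))) : ℝ))⁻¹ ^ (i + 1))| ≤
          (((∏ j, Nat.card (G j) : ℕ) : ℝ) ^ n)⁻¹ * ε := by
  obtain ⟨M, η, hη, hs⟩ := sieve (fun j => (Nat.card (IsLocalRing.ResidueField (AdjoinRoot (P j))) : ℝ)) hq ε hε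
  set c : ℝ := ∑ m : ι → Fin (M + 2), (Nat.card (AddSubgroup (∀ j, VV P (fun j => (m j : ℕ)) j)) : ℝ) with hc
  have hlim : Tendsto (fun k : ℕ => c / 2 ^ k) atTop (𝓝 0) :=
    tendsto_const_nhds.div_atTop (tendsto_pow_atTop_atTop_of_one_lt (by norm_num : (1 : ℝ) < 2))
  obtain ⟨k0, hk0⟩ := (hlim.eventually (gt_mem_nhds hη)).exists_forall_of_atTop
  refine ⟨k0 + ∏ j, Nat.card (G j), fun n hn μ _ _ g hg => ?_⟩
  refine hs μ (Ev P g) (BB P g) (rr P g) (fun m => Ycount P (VV P m) g) _ (by positivity)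
    (fun m => (Y_int μ g hg).2) (fun m X hX => Y_eq g m X hX) (fun m X hX => Y_eq_zero g m X hX)
    (fun m hm => ?_) (fun m hm => Y_upper hP μ g hg) (BB_meas μ hq g hg) (mem_BB g)
  refine le_trans (mul_le_mul_of_nonneg_left ?_ (by positivity)) (Y_lower hP μ g hg)
  have h1 : (Nat.card (AddSubgroup (∀ j, VV P m j)) : ℝ) ≤ c := by
    have := Finset.single_le_sum (f := fun m : ι → Fin (M + 2) =>
      (Nat.card (AddSubgroup (∀ j, VV P (fun j => (m j : ℕ)) j)) : ℝ)) (s := Finset.univ)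
      (fun _ _ => Nat.cast_nonneg _) (Finset.mem_univ (fun j => ⟨m j, Nat.lt_succ_of_le (hm j)⟩))
    exact this
  have h2 := hk0 (n - ∏ j, Nat.card (G j)) (by omega)
  have h3 : (Nat.card (AddSubgroup (∀ j, VV P m j)) : ℝ) / 2 ^ (n - ∏ j, Nat.card (G j)) ≤
      c / 2 ^ (n - ∏ j, Nat.card (G j)) := by gcongr
  linarith

end App

end PartB3

section PartB4
open Filter Topology MeasureTheory Polynomial

lemma card_pres {R M : Type} [CommRing R] [AddCommGroup M] [Module R M] [Finite M] {n : ℕ}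
    (C : Submodule R (Fin n → R)) [Decidable (Nonempty (((Fin n → R) ⧸ C) ≃ₗ[R] M))] :
    Nat.card {g : Fin n → M // Function.Surjective (Fintype.linearCombination R g) ∧
      C = LinearMap.ker (Fintype.linearCombination R g)} =
    if Nonempty (((Fin n → R) ⧸ C) ≃ₗ[R] M) then Nat.card (M ≃ₗ[R] M) else 0 := by
  have e : {g : Fin n → M // Function.Surjective (Fintype.linearCombination R g) ∧
      C = LinearMap.ker (Fintype.linearCombination R g)} ≃ (((Fin n → R) ⧸ C) ≃ₗ[R] M) := by
    refine Equiv.ofBijective (fun g => (Submodule.quotEquivOfEq _ _ g.2.2).trans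
      (LinearMap.quotKerEquivOfSurjective _ g.2.1)) ⟨?_, ?_⟩
    · intro g g' h
      apply Subtype.ext
      funext k
      have := LinearEquiv.congr_fun h (Submodule.Quotient.mk (Pi.single k 1))
      simpa [Fintype.linearCombination_apply_single] using this
    · intro φ
      have hl : Fintype.linearCombination R (fun k => φ (C.mkQ (Pi.single k 1))) =
          φ.toLinearMap.comp C.mkQ := by
        refine LinearMap.pi_ext' fun k => LinearMap.ext_ring ?_
        simp [Fintype.linearCombination_apply_single]
      refine ⟨⟨fun k => φ (C.mkQ (Pi.single k 1)), ?_, ?_⟩, ?_⟩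
      · rw [hl]; exact φ.surjective.comp (Submodule.mkQ_surjective C)
      · rw [hl, LinearEquiv.ker_comp, Submodule.ker_mkQ]
      · ext x
        obtain ⟨x, rfl⟩ := Submodule.Quotient.mk_surjective _ x
        exact LinearMap.congr_fun hl x
  rw [Nat.card_congr e]
  split_ifs with h
  · obtain ⟨φ⟩ := h
    exact Nat.card_congr
      { toFun := fun ψ => φ.symm.trans ψ
        invFun := fun ψ => φ.trans ψ
        left_inv := fun ψ => by ext; simp
        right_inv := fun ψ => by ext; simp }
  · haveI := not_nonempty_iff.1 h
    exact Nat.card_of_isEmpty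

section Fin
variable {p : ℕ} [Fact p.Prime] {ι : Type} [Fintype ι] [DecidableEq ι] {P : ι → ℤ_[p][X]}
  [∀ j, IsDomain (AdjoinRoot (P j))] [∀ j, IsDiscreteValuationRing (AdjoinRoot (P j))]
  [∀ j, CharZero (AdjoinRoot (P j))] [∀ j, Finite (IsLocalRing.ResidueField (AdjoinRoot (P j)))]
  {G : ι → Type} [∀ j, AddCommGroup (G j)] [∀ j, Module (AdjoinRoot (P j)) (G j)] [∀ j, Finite (G j)]

/-- isomorphism event -/
def EE {n : ℕ} (P : ι → ℤ_[p][X]) (G : ι → Type) [∀ j, AddCommGroup (G j)]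
    [∀ j, Module (AdjoinRoot (P j)) (G j)] : Set (Fin n → Fin n → ℤ_[p]) :=
  {X | ∀ j, Nonempty (((Fin n → AdjoinRoot (P j)) ⧸ colSpan (P j) X) ≃ₗ[AdjoinRoot (P j)] G j)}

lemma card_BB {n : ℕ} (hP : Pairwise (Function.onFun IsCoprime P)) (X : Fin n → Fin n → ℤ_[p]) :
    (Nat.card {g : {g : ∀ j, Fin n → G j // Gen g} // X ∈ BB P g.1} : ℝ) =
      (EE P G).indicator (fun _ => ∏ j, (Nat.card (G j ≃ₗ[AdjoinRoot (P j)] G j) : ℝ)) X := by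
  classical
  have h1 : Nat.card {g : {g : ∀ j, Fin n → G j // Gen g} // X ∈ BB P g.1} =
      Nat.card (∀ j, {g : Fin n → G j // Function.Surjective (Fintype.linearCombination (AdjoinRoot (P j)) g) ∧
      colSpan (P j) X = LinearMap.ker (Fintype.linearCombination (AdjoinRoot (P j)) g)}) := by
    refine Nat.card_congr
      { toFun := fun g j => ⟨g.1.1 j, lc_surj_of_gen g.1.1 g.1.2 j, g.2 j⟩
        invFun := fun g => ⟨⟨fun j => (g j).1, ?_⟩, fun j => (g j).2.2⟩
        left_inv := fun g => rfl
        right_inv := fun g => rfl }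
    refine Ev_gen hP (X := X) _ (fun j => ?_) ((mem_Ev_g _ _).2 fun j => (g j).2.2.le)
    rw [← Fintype.range_linearCombination]
    exact LinearMap.range_eq_top.2 (g j).2.1
  rw [h1, Nat.card_pi, Finset.prod_congr rfl fun j _ => card_pres (colSpan (P j) X), Set.indicator_apply]
  split_ifs with h
  · rw [Nat.cast_prod]
    exact Finset.prod_congr rfl fun j _ => by rw [if_pos (h j)]
  · simp only [EE, Set.mem_setOf_eq, not_forall] at h
    obtain ⟨j, hj⟩ := h
    rw [Finset.prod_eq_zero (Finset.mem_univ j) (if_neg hj), Nat.cast_zero]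

lemma aut_pos : 0 < ∏ j, (Nat.card (G j ≃ₗ[AdjoinRoot (P j)] G j) : ℝ) := by
  refine Finset.prod_pos fun j _ => Nat.cast_pos.2 ?_
  haveI : Finite (G j ≃ₗ[AdjoinRoot (P j)] G j) := DFunLike.finite _
  haveI : Nonempty (G j ≃ₗ[AdjoinRoot (P j)] G j) := ⟨LinearEquiv.refl _ _⟩
  exact Nat.card_pos

lemma EE_real {n : ℕ} (μ : Measure (Fin n → Fin n → ℤ_[p])) [IsProbabilityMeasure μ] [μ.IsAddHaarMeasure]
    (hP : Pairwise (Function.onFun IsCoprime P))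
    (hq : ∀ j, 2 ≤ (Nat.card (IsLocalRing.ResidueField (AdjoinRoot (P j))) : ℝ))
    [Fintype {g : ∀ j, Fin n → G j // Gen g}] :
    μ.real (EE P G) * ∏ j, (Nat.card (G j ≃ₗ[AdjoinRoot (P j)] G j) : ℝ) =
      ∑ g : {g : ∀ j, Fin n → G j // Gen g}, μ.real (BB P g.1) := by
  have h := count_int μ (fun g : {g : ∀ j, Fin n → G j // Gen g} => BB P g.1) (fun g => BB_meas μ hq g.1 g.2)
  have hE : MeasurableSet (EE (n := n) P G) := by
    have : EE (n := n) P G = (fun X => (Nat.card {g : {g : ∀ j, Fin n → G j // Gen g} // X ∈ BB P g.1} : ℝ)) ⁻¹'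
        {0}ᶜ := by
      ext X
      rw [Set.mem_preimage, card_BB hP, Set.mem_compl_singleton_iff]
      have := (aut_pos (P := P) (G := G)).ne'
      by_cases hX : X ∈ EE P G
      · simp only [hX, Set.indicator_of_mem, true_iff]; exact this
      · simp [hX]
    rw [this]
    exact h.1 (measurableSet_singleton 0).compl
  rw [← h.2.2]
  simp only [card_BB hP]
  rw [integral_indicator_const _ hE, smul_eq_mul]

lemma gen_card (n : ℕ) :
    (Nat.card {g : ∀ j, Fin n → G j // Gen g} : ℝ) * (((∏ j, Nat.card (G j) : ℕ) : ℝ) ^ n)⁻¹ ≤ 1 ∧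
    1 - (Nat.card (AddSubgroup (∀ j, G j)) : ℝ) / 2 ^ n ≤
    (Nat.card {g : ∀ j, Fin n → G j // Gen g} : ℝ) * (((∏ j, Nat.card (G j) : ℕ) : ℝ) ^ n)⁻¹ := by
  classical
  have hb := bad_count (AddMonoidHom.id (Fin n → ∀ j, G j)) (fun x => ⟨x, rfl⟩)
  have hW : Nat.card (Fin n → ∀ j, G j) = (∏ j, Nat.card (G j)) ^ n := by
    rw [Nat.card_fun, Nat.card_pi, Nat.card_fin]
  have h1 : Nat.card {g : ∀ j, Fin n → G j // Gen g} +
      Nat.card {a : Fin n → ∀ j, G j // AddSubgroup.closure (Set.range (AddMonoidHom.id (Fin n → ∀ j, G j) a)) ≠ ⊤} =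
      Nat.card (Fin n → ∀ j, G j) := by
    have e : {g : ∀ j, Fin n → G j // Gen g} ≃ {a : Fin n → ∀ j, G j //
        AddSubgroup.closure (Set.range (AddMonoidHom.id (Fin n → ∀ j, G j) a)) = ⊤} :=
      { toFun := fun g => ⟨fun k j => g.1 j k, g.2⟩
        invFun := fun g => ⟨fun j k => g.1 k j, g.2⟩
        left_inv := fun g => rfl
        right_inv := fun g => rfl }
    rw [Nat.card_congr e, ← Nat.card_sum]
    exact Nat.card_congr (Equiv.sumCompl _)
  rw [hW] at h1 hb
  rw [Fintype.card_fin] at hb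
  set A := Nat.card {g : ∀ j, Fin n → G j // Gen g}
  set B := Nat.card {a : Fin n → ∀ j, G j // AddSubgroup.closure (Set.range (AddMonoidHom.id (Fin n → ∀ j, G j) a)) ≠ ⊤}
  have hpos : (0 : ℝ) < ((∏ j, Nat.card (G j) : ℕ) : ℝ) ^ n :=
    pow_pos (Nat.cast_pos.2 (Finset.prod_pos fun j _ => Nat.card_pos)) n
  have h1' : (A : ℝ) + B = ((∏ j, Nat.card (G j) : ℕ) : ℝ) ^ n := by exact_mod_cast h1
  have hb' : (B : ℝ) * 2 ^ n ≤ Nat.card (AddSubgroup (∀ j, G j)) * ((∏ j, Nat.card (G j) : ℕ) : ℝ) ^ n := by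
    exact_mod_cast hb
  rw [← div_eq_mul_inv]
  have hB : (0 : ℝ) ≤ B := Nat.cast_nonneg _
  constructor
  · rw [div_le_one hpos]; linarith
  · rw [le_div_iff₀ hpos, sub_mul, one_mul, sub_le_iff_le_add, ← h1']
    rw [h1']
    have : (B : ℝ) ≤ Nat.card (AddSubgroup (∀ j, G j)) / 2 ^ n * ((∏ j, Nat.card (G j) : ℕ) : ℝ) ^ n := by
      rw [div_mul_eq_mul_div, le_div_iff₀ (by positivity)]; exact hb'
    linarith

lemma EE_tendsto (hP : Pairwise (Function.onFun IsCoprime P))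
    (hq : ∀ j, 2 ≤ (Nat.card (IsLocalRing.ResidueField (AdjoinRoot (P j))) : ℝ))
    (μ : ∀ n : ℕ, Measure (Fin n → Fin n → ℤ_[p])) (hμ1 : ∀ n, IsProbabilityMeasure (μ n))
    (hμ2 : ∀ n, (μ n).IsAddHaarMeasure) :
    Tendsto (fun n => (μ n).real (EE P G)) atTop (𝓝 (∏ j, (1 / (Nat.card (G j ≃ₗ[AdjoinRoot (P j)] G j) : ℝ)) *
      ∏' i : ℕ, (1 - ((Nat.card (IsLocalRing.ResidueField (AdjoinRoot (P j))) : ℝ))⁻¹ ^ (i + 1)))) := by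
  classical
  rw [Finset.prod_mul_distrib]
  set L := ∏ j, ∏' i : ℕ, (1 - ((Nat.card (IsLocalRing.ResidueField (AdjoinRoot (P j))) : ℝ))⁻¹ ^ (i + 1)) with hL
  set a := ∏ j, (Nat.card (G j ≃ₗ[AdjoinRoot (P j)] G j) : ℝ) with ha
  have ha0 : 0 < a := aut_pos
  have hinv : ∏ j, (1 / (Nat.card (G j ≃ₗ[AdjoinRoot (P j)] G j) : ℝ)) = a⁻¹ := by
    rw [ha, ← Finset.prod_inv_distrib]; simp
  rw [hinv]
  set N : ℕ → ℝ := fun n => (Nat.card {g : ∀ j, Fin n → G j // Gen g} : ℝ) *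
    (((∏ j, Nat.card (G j) : ℕ) : ℝ) ^ n)⁻¹ with hN
  have hN1 : Tendsto N atTop (𝓝 1) := by
    have h0 : Tendsto (fun n : ℕ => 1 - (Nat.card (AddSubgroup (∀ j, G j)) : ℝ) / 2 ^ n) atTop (𝓝 (1 - 0)) :=
      tendsto_const_nhds.sub (tendsto_const_nhds.div_atTop
        (tendsto_pow_atTop_atTop_of_one_lt (by norm_num : (1 : ℝ) < 2)))
    rw [sub_zero] at h0
    exact tendsto_of_tendsto_of_tendsto_of_le_of_le h0 tendsto_const_nhds (fun n => (gen_card n).2)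
      (fun n => (gen_card n).1)
  have hdiff : Tendsto (fun n => (μ n).real (EE P G) * a - N n * L) atTop (𝓝 0) := by
    rw [Metric.tendsto_atTop]
    intro ε hε
    obtain ⟨n0, hn0⟩ := gen_limit (G := G) hP hq (ε / 2) (by linarith)
    refine ⟨n0, fun n hn => ?_⟩
    haveI := hμ1 n
    haveI := hμ2 n
    haveI : Fintype {g : ∀ j, Fin n → G j // Gen g} := Fintype.ofFinite _
    rw [Real.dist_eq, sub_zero, ha, EE_real (μ n) hP hq]
    have h1 : N n * L = ∑ g : {g : ∀ j, Fin n → G j // Gen g}, (((∏ j, Nat.card (G j) : ℕ) : ℝ) ^ n)⁻¹ * L := by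
      rw [Finset.sum_const, nsmul_eq_mul, Finset.card_univ, ← Nat.card_eq_fintype_card, hN, mul_assoc]
    rw [h1, ← Finset.sum_sub_distrib]
    refine lt_of_le_of_lt (Finset.abs_sum_le_sum_abs _ _) ?_
    refine lt_of_le_of_lt (Finset.sum_le_sum fun g _ => hn0 n hn (μ n) g.1 g.2) ?_
    rw [Finset.sum_const, nsmul_eq_mul, Finset.card_univ, ← Nat.card_eq_fintype_card, ← mul_assoc]
    have := (gen_card (G := G) n).1
    nlinarith
  have h2 := (hdiff.add (hN1.mul_const L)).const_mul a⁻¹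
  simp only [sub_add_cancel, zero_add, one_mul] at h2
  refine h2.congr fun n => ?_
  field_simp

end Fin

theorem main_13 (p : ℕ) [Fact p.Prime] (l : ℕ) (hl : 1 ≤ l)
    (P : Fin l → Polynomial ℤ_[p]) (hmonic : ∀ j, (P j).Monic)
    (hdeg : ∀ j, (P j).natDegree ≤ 2)
    (hirr : ∀ j, Irreducible ((P j).map (PadicInt.toZMod : ℤ_[p] →+* ZMod p)))
    (hdist : ∀ j k, j ≠ k →
      (P j).map (PadicInt.toZMod : ℤ_[p] →+* ZMod p) ≠
      (P k).map (PadicInt.toZMod : ℤ_[p] →+* ZMod p))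
    (G : Fin l → Type) [∀ j, AddCommGroup (G j)]
    [∀ j, Module (AdjoinRoot (P j)) (G j)] [∀ j, Finite (G j)]
    (μ : ∀ n : ℕ, Measure (Fin n → Fin n → ℤ_[p]))
    (hμ1 : ∀ n, IsProbabilityMeasure (μ n))
    (hμ2 : ∀ n, (μ n).IsAddHaarMeasure) :
    Filter.Tendsto (fun n =>
      ((μ n) {X | ∀ j, Nonempty (((Fin n → ℤ_[p]) ⧸
        LinearMap.range (Polynomial.aeval (Matrix.of X) (P j)).mulVecLin) ≃+ G j)}).toReal)
      Filter.atTop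
      (nhds (∏ j, (1 / (Nat.card (G j ≃ₗ[AdjoinRoot (P j)] G j) : ℝ)) *
        ∏' i : ℕ, (1 - ((p : ℝ) ^ (P j).natDegree)⁻¹ ^ (i + 1)))) := by
  haveI i1 : ∀ j, IsDomain (AdjoinRoot (P j)) := fun j => R_isDomain (hmonic j) (hirr j)
  haveI i2 : ∀ j, IsDiscreteValuationRing (AdjoinRoot (P j)) := fun j => (R_dvr (hmonic j) (hirr j)).2
  haveI i3 : ∀ j, CharZero (AdjoinRoot (P j)) := fun j =>
    charZero_of_injective_algebraMap (R_inj (hmonic j) (hirr j))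
  have hres : ∀ j, Nat.card (IsLocalRing.ResidueField (AdjoinRoot (P j))) = p ^ (P j).natDegree :=
    fun j => R_res (hmonic j) (hirr j) _
  have hp : p.Prime := Fact.out
  haveI i4 : ∀ j, Finite (IsLocalRing.ResidueField (AdjoinRoot (P j))) := fun j =>
    Nat.finite_of_card_ne_zero (by rw [hres]; exact pow_ne_zero _ hp.ne_zero)
  have hd : ∀ j, (P j).natDegree ≠ 0 := fun j => by
    rw [← (hmonic j).natDegree_map (PadicInt.toZMod : ℤ_[p] →+* ZMod p)]
    exact (hirr j).natDegree_pos.ne'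
  have hq : ∀ j, 2 ≤ Nat.card (IsLocalRing.ResidueField (AdjoinRoot (P j))) := fun j => by
    rw [hres]; exact hp.two_le.trans (Nat.le_self_pow (hd j) p)
  have hP : Pairwise (Function.onFun IsCoprime P) := fun i j hij =>
    R_coprime (hmonic i) (hirr i) (hmonic j) (hirr j) (hdist i j hij)
  have h := EE_tendsto (P := P) (G := G) hP (fun j => by exact_mod_cast hq j) μ hμ1 hμ2
  simp only [hres, Nat.cast_pow] at h
  convert h using 1
  funext n
  rw [Measure.real]
  congr 2
  ext X
  refine forall_congr' fun j => ?_
  obtain ⟨e⟩ := cok_equiv (P j) X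
  constructor
  · rintro ⟨f⟩
    haveI : Finite ((Fin n → AdjoinRoot (P j)) ⧸ colSpan (P j) X) :=
      Finite.of_equiv _ (f.symm.trans e).toEquiv
    exact equiv_of_addEquiv p (R_maxIdeal (hmonic j) (hirr j) _) (hq j) _ _ (e.symm.trans f)
  · rintro ⟨f⟩
    exact ⟨e.trans f.toAddEquiv⟩

end PartB4

end Helpers13

/-- Theorem 1.1: for monic `P_1,…,P_l ∈ ℤ_p[t]` of degree ≤ 2 with distinct
irreducible reductions mod `p`, and finite `ℤ_p[t]/(P_j)`-modules `G_j`, the Haar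
probability that `cok(P_j(X)) ≃ G_j` for all `j` tends, as `n → ∞`, to
`∏_j |Aut(G_j)|⁻¹ ∏_{i≥1} (1 - p^{-i·deg P_j})`.  (Per the paper's remark, finite
`ℤ_p[t]/(P_j)`-modules are isomorphic iff they are isomorphic as abelian groups,
so the cokernel condition is stated via `≃+`.) -/
theorem stmt_13 (p : ℕ) [Fact p.Prime] (l : ℕ) (hl : 1 ≤ l)
    (P : Fin l → Polynomial ℤ_[p]) (hmonic : ∀ j, (P j).Monic)
    (hdeg : ∀ j, (P j).natDegree ≤ 2)
    (hirr : ∀ j, Irreducible ((P j).map (PadicInt.toZMod : ℤ_[p] →+* ZMod p)))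
    (hdist : ∀ j k, j ≠ k →
      (P j).map (PadicInt.toZMod : ℤ_[p] →+* ZMod p) ≠
      (P k).map (PadicInt.toZMod : ℤ_[p] →+* ZMod p))
    (G : Fin l → Type) [∀ j, AddCommGroup (G j)]
    [∀ j, Module (AdjoinRoot (P j)) (G j)] [∀ j, Finite (G j)]
    (μ : ∀ n : ℕ, Measure (Fin n → Fin n → ℤ_[p]))
    (hμ1 : ∀ n, IsProbabilityMeasure (μ n))
    (hμ2 : ∀ n, (μ n).IsAddHaarMeasure) :
    Filter.Tendsto (fun n =>
      ((μ n) {X | ∀ j, Nonempty (((Fin n → ℤ_[p]) ⧸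
        LinearMap.range (Polynomial.aeval (Matrix.of X) (P j)).mulVecLin) ≃+ G j)}).toReal)
      Filter.atTop
      (nhds (∏ j, (1 / (Nat.card (G j ≃ₗ[AdjoinRoot (P j)] G j) : ℝ)) *
        ∏' i : ℕ, (1 - ((p : ℝ) ^ (P j).natDegree)⁻¹ ^ (i + 1)))) := by
  exact main_13 p l hl P hmonic hdeg hirr hdist G μ hμ1 hμ2
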